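/- Let α > 0 be a real number. Then as x → ∞, Σ_{p ≤ √x, p prime} p^{-α} Σ_{q < p, q prime} q^{α} = (2/(α+1))·x/(log x)^2 + ((4α+8)/(α+1)²)·x/(log x)^3 + O(x/(log x)^4). -/

import Mathlib

open Filter Finset

namespace PrimeSums

open Complex Topology

/-- The `n`-th term of the series for `(s - 1) ζ(s) - 1` coming from comparing a sum and an integral. -/
noncomputable def zetaTerm (n : ℕ) (s : ℂ) : ℂ :=
  (s - 1) * (n : ℂ) ^ (-s) + (((n : ℂ) + 1) ^ (1 - s) - (n : ℂ) ^ (1 - s))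

lemma norm_zetaTerm_le_of_bound {n : ℕ} (hn : 1 ≤ n) {s : ℂ} {B : ℝ}
    (hB : ∀ u ∈ Set.Icc (n : ℝ) (n + 1), ‖(n : ℂ) ^ (-s) - (u : ℂ) ^ (-s)‖ ≤ B) :
    ‖zetaTerm n s‖ ≤ ‖s - 1‖ * B := by
  by_cases hs1 : s = 1
  · subst hs1; simp [zetaTerm]
  have hn' : (0 : ℝ) < n := by exact_mod_cast hn
  have key := Convex.norm_image_sub_le_of_norm_hasDerivWithin_le (𝕜 := ℝ)
    (f := fun u : ℝ => (s - 1) * (n : ℂ) ^ (-s) * (u : ℂ) + (u : ℂ) ^ (1 - s))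
    (f' := fun u : ℝ => (s - 1) * ((n : ℂ) ^ (-s) - (u : ℂ) ^ (-s)))
    (s := Set.Icc (n : ℝ) (n + 1)) (C := ‖s - 1‖ * B) (x := n) (y := n + 1)
    (fun u hu => by
      have hu0 : u ≠ 0 := (hn'.trans_le hu.1).ne'
      have h3 : 1 - s ≠ 0 := fun h => hs1 (by linear_combination -h)
      have h1 := hasDerivAt_ofReal_cpow_const (r := 1 - s) hu0 h3
      have h2 : HasDerivAt (fun u : ℝ => (s - 1) * (n : ℂ) ^ (-s) * (u : ℂ))
        ((s - 1) * (n : ℂ) ^ (-s)) u := by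
        simpa using (Complex.ofRealCLM.hasDerivAt (x := u)).const_mul ((s - 1) * (n : ℂ) ^ (-s))
      refine ((h2.add h1).congr_deriv ?_).hasDerivWithinAt
      rw [show 1 - s - 1 = -s by ring]; ring)
    (fun u hu => by rw [norm_mul]; gcongr; exact hB u hu)
    (convex_Icc _ _) (by simp) (by simp)
  rw [add_sub_cancel_left, norm_one, mul_one] at key
  have e : zetaTerm n s = (s - 1) * (n : ℂ) ^ (-s) * ((n + 1 : ℝ) : ℂ) + ((n + 1 : ℝ) : ℂ) ^ (1 - s) -
      ((s - 1) * (n : ℂ) ^ (-s) * ((n : ℝ) : ℂ) + ((n : ℝ) : ℂ) ^ (1 - s)) := by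
    simp only [zetaTerm]; push_cast; ring
  rw [e]; exact key

lemma norm_cpow_sub_cpow_le {n : ℕ} (hn : 1 ≤ n) {s : ℂ} (hs : 0 ≤ s.re) {u : ℝ}
    (hu : u ∈ Set.Icc (n : ℝ) (n + 1)) :
    ‖(n : ℂ) ^ (-s) - (u : ℂ) ^ (-s)‖ ≤ ‖s‖ * (n : ℝ) ^ (-s.re - 1) := by
  have hn' : (0 : ℝ) < n := by exact_mod_cast hn
  by_cases hs0 : s = 0
  · subst hs0; simp
  have key := Convex.norm_image_sub_le_of_norm_hasDerivWithin_le (𝕜 := ℝ)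
    (f := fun u : ℝ => (u : ℂ) ^ (-s))
    (f' := fun u : ℝ => -s * (u : ℂ) ^ (-s - 1))
    (s := Set.Icc (n : ℝ) (n + 1)) (C := ‖s‖ * (n : ℝ) ^ (-s.re - 1)) (x := u) (y := n)
    (fun u hu => by
      have hu0 : 0 < u := (hn'.trans_le hu.1)
      exact (hasDerivAt_ofReal_cpow_const hu0.ne' (neg_ne_zero.mpr hs0)).hasDerivWithinAt)
    (fun u hu => by
      have hu0 : 0 < u := (hn'.trans_le hu.1)
      rw [norm_mul, norm_neg, norm_cpow_eq_rpow_re_of_pos hu0]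
      gcongr
      simp only [sub_re, neg_re, one_re]
      exact Real.rpow_le_rpow_of_nonpos hn' hu.1 (by linarith))
    (convex_Icc _ _) hu (by simp)
  refine key.trans (mul_le_of_le_one_right (by positivity) ?_)
  rw [Real.norm_eq_abs, abs_le]; constructor <;> linarith [hu.1, hu.2]

lemma norm_cpow_sub_cpow_le' {n : ℕ} (hn : 1 ≤ n) {s : ℂ} (hs : 0 ≤ s.re) {u : ℝ}
    (hu : u ∈ Set.Icc (n : ℝ) (n + 1)) :
    ‖(n : ℂ) ^ (-s) - (u : ℂ) ^ (-s)‖ ≤ 2 * (n : ℝ) ^ (-s.re) := by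
  have hn' : (0 : ℝ) < n := by exact_mod_cast hn
  have hu0 : 0 < u := (hn'.trans_le hu.1)
  refine (norm_sub_le _ _).trans ?_
  rw [norm_cpow_eq_rpow_re_of_pos hu0, ← ofReal_natCast, norm_cpow_eq_rpow_re_of_pos hn', neg_re]
  have := Real.rpow_le_rpow_of_nonpos hn' hu.1 (z := -s.re) (by linarith)
  linarith

lemma norm_zetaTerm_le {n : ℕ} (hn : 1 ≤ n) {s : ℂ} {δ : ℝ} (hδ : 0 ≤ δ) (hδ' : δ ≤ 1 / 2)
    (hs : 1 - δ ≤ s.re) :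
    ‖zetaTerm n s‖ ≤ ‖s - 1‖ * (2 * ‖s‖ ^ (2 * δ) * (n : ℝ) ^ (-(1 + δ))) := by
  have hn' : (0 : ℝ) < n := by exact_mod_cast hn
  have hn1 : (1 : ℝ) ≤ n := by exact_mod_cast hn
  have hs0 : 0 ≤ s.re := by linarith
  refine norm_zetaTerm_le_of_bound hn fun u hu => ?_
  have h1 := norm_cpow_sub_cpow_le hn hs0 hu
  have h2 := norm_cpow_sub_cpow_le' hn hs0 hu
  set X := ‖(n : ℂ) ^ (-s) - (u : ℂ) ^ (-s)‖ with hX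
  have hX0 : 0 ≤ X := norm_nonneg _
  have e1 : X = X ^ (2 * δ) * X ^ (1 - 2 * δ) := by
    rcases hX0.eq_or_lt with h | h
    · rw [← h]
      by_cases hd : δ = 0
      · subst hd; simp
      · rw [Real.zero_rpow (by positivity)]; simp
    · rw [← Real.rpow_add h]; simp
  rw [e1]
  have h3 : X ^ (2 * δ) ≤ (‖s‖ * (n : ℝ) ^ (-s.re - 1)) ^ (2 * δ) :=
    Real.rpow_le_rpow hX0 h1 (by linarith)
  have h4 : X ^ (1 - 2 * δ) ≤ (2 * (n : ℝ) ^ (-s.re)) ^ (1 - 2 * δ) :=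
    Real.rpow_le_rpow hX0 h2 (by linarith)
  refine (mul_le_mul h3 h4 (by positivity) (by positivity)).trans ?_
  rw [Real.mul_rpow (by positivity) (by positivity), Real.mul_rpow (by positivity) (by positivity),
    ← Real.rpow_mul hn'.le, ← Real.rpow_mul hn'.le]
  have h5 : (2 : ℝ) ^ (1 - 2 * δ) ≤ 2 := by
    calc (2 : ℝ) ^ (1 - 2 * δ) ≤ 2 ^ (1 : ℝ) :=
          Real.rpow_le_rpow_of_exponent_le (by norm_num) (by linarith)
      _ = 2 := by simp
  have h6 : (n : ℝ) ^ ((-s.re - 1) * (2 * δ)) * (n : ℝ) ^ (-s.re * (1 - 2 * δ)) ≤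
      (n : ℝ) ^ (-(1 + δ)) := by
    rw [← Real.rpow_add hn']
    exact Real.rpow_le_rpow_of_exponent_le hn1 (by linarith)
  calc _ = 2 ^ (1 - 2 * δ) * ‖s‖ ^ (2 * δ) *
        ((n : ℝ) ^ ((-s.re - 1) * (2 * δ)) * (n : ℝ) ^ (-s.re * (1 - 2 * δ))) := by ring
    _ ≤ _ := by gcongr

lemma summable_nat_add_one_rpow {δ : ℝ} (hδ : 0 < δ) :
    Summable fun n : ℕ => ((n + 1 : ℕ) : ℝ) ^ (-(1 + δ)) :=
  (summable_nat_add_iff 1).mpr (Real.summable_nat_rpow.mpr (by linarith))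

lemma riemannZeta₁_eq_of_one_lt_re {s : ℂ} (hs : 1 < s.re) :
    riemannZeta₁ s = 1 + ∑' n : ℕ, zetaTerm (n + 1) s := by
  have hs1 : s ≠ 1 := by rintro rfl; simp at hs
  have hz : riemannZeta₁ s = (s - 1) * riemannZeta s := by
    rw [riemannZeta_eq_inv_sub_mul hs1, ← mul_assoc, mul_inv_cancel₀ (sub_ne_zero.mpr hs1), one_mul]
  have hsum : Summable fun n : ℕ => 1 / ((n : ℂ) + 1) ^ s := by
    have := (summable_nat_add_iff 1).mpr (Complex.summable_one_div_nat_cpow.mpr hs)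
    simpa using this
  have h1 : HasSum (fun n : ℕ => (s - 1) * (1 / ((n : ℂ) + 1) ^ s)) (riemannZeta₁ s) := by
    rw [hz, zeta_eq_tsum_one_div_nat_add_one_cpow hs]
    exact hsum.hasSum.mul_left _
  have h2 : HasSum (fun n : ℕ => (((n + 1 : ℕ) : ℂ) + 1) ^ (1 - s) - (((n + 1 : ℕ) : ℂ)) ^ (1 - s)) (-1) := by
    have hlim : Tendsto (fun n : ℕ => (((n + 1 : ℕ) : ℂ)) ^ (1 - s)) atTop (𝓝 0) := by
      rw [tendsto_zero_iff_norm_tendsto_zero]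
      have : Tendsto (fun n : ℕ => (((n + 1 : ℕ) : ℝ)) ^ (-(s.re - 1))) atTop (𝓝 0) :=
        ((tendsto_rpow_neg_atTop (by linarith : 0 < s.re - 1)).comp
          tendsto_natCast_atTop_atTop).comp (tendsto_add_atTop_nat 1)
      refine this.congr fun n => ?_
      rw [← ofReal_natCast, norm_cpow_eq_rpow_re_of_pos (by positivity)]
      simp
    have hS : Summable fun n : ℕ =>
        (((n + 1 : ℕ) : ℂ) + 1) ^ (1 - s) - (((n + 1 : ℕ) : ℂ)) ^ (1 - s) := by
      have ha : Summable fun n : ℕ => zetaTerm (n + 1) s := by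
        refine Summable.of_norm_bounded (((summable_nat_add_one_rpow
          (δ := 1 / 2) (by norm_num)).mul_left (2 * ‖s‖ ^ (2 * (1 / 2) : ℝ))).mul_left ‖s - 1‖)
          fun n => norm_zetaTerm_le (by omega) (by norm_num) le_rfl (by linarith)
      refine (ha.sub h1.summable).congr fun n => ?_
      simp only [zetaTerm, cpow_neg]; push_cast; ring
    refine (hS.hasSum_iff_tendsto_nat).mpr ?_
    have := hlim.sub_const 1
    rw [zero_sub] at this
    refine this.congr fun n => ?_
    have e := Finset.sum_range_sub (fun n : ℕ => (((n + 1 : ℕ) : ℂ)) ^ (1 - s)) n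
    push_cast at e ⊢
    rw [e]; simp
  have h3 := h1.add h2
  have h4 : ∑' n : ℕ, zetaTerm (n + 1) s = riemannZeta₁ s + -1 := by
    rw [← h3.tsum_eq]
    refine tsum_congr fun n => ?_
    simp only [zetaTerm, cpow_neg]; push_cast; ring
  rw [h4]; ring

lemma differentiable_zetaTerm (n : ℕ) : Differentiable ℂ (zetaTerm (n + 1)) := by
  have h1 : ((n + 1 : ℕ) : ℂ) ≠ 0 := Nat.cast_ne_zero.mpr (by omega)
  have h2 : ((n + 1 : ℕ) : ℂ) + 1 ≠ 0 := by
    have := Nat.cast_ne_zero (R := ℂ).mpr (show n + 1 + 1 ≠ 0 by omega)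
    push_cast at this ⊢; exact this
  unfold zetaTerm
  refine Differentiable.add (Differentiable.mul (by fun_prop) ?_) (Differentiable.sub ?_ ?_)
  · exact Differentiable.const_cpow (by fun_prop) (Or.inl h1)
  · exact Differentiable.const_cpow (by fun_prop) (Or.inl h2)
  · exact Differentiable.const_cpow (by fun_prop) (Or.inl h1)

lemma riemannZeta₁_eq {δ : ℝ} (hδ : 0 < δ) (hδ' : δ ≤ 1 / 2) {s : ℂ} (hs : 1 - δ < s.re) :
    riemannZeta₁ s = 1 + ∑' n : ℕ, zetaTerm (n + 1) s := by
  set U : Set ℂ := {s | 1 - δ < s.re} with hU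
  have hUo : IsOpen U := isOpen_lt continuous_const continuous_re
  have hUc : IsPreconnected U := (convex_halfSpace_re_gt (1 - δ)).isPreconnected
  have hd : DifferentiableOn ℂ (fun s => 1 + ∑' n : ℕ, zetaTerm (n + 1) s) U := by
    refine (differentiableOn_const _).add fun z hz => ?_
    set V : Set ℂ := U ∩ Metric.ball 0 (‖z‖ + 1)
    have hVo : IsOpen V := hUo.inter Metric.isOpen_ball
    have hzV : z ∈ V := ⟨hz, by simp⟩
    have : DifferentiableOn ℂ (fun s => ∑' n : ℕ, zetaTerm (n + 1) s) V := by
      refine differentiableOn_tsum_of_summable_norm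
        (((summable_nat_add_one_rpow hδ).mul_left (2 * (‖z‖ + 1) ^ (2 * δ))).mul_left
          (‖z‖ + 2)) (fun n => (differentiable_zetaTerm n).differentiableOn) hVo fun n w hw => ?_
      have hw1 : ‖w‖ ≤ ‖z‖ + 1 := by simpa using (mem_ball_zero_iff.mp hw.2).le
      refine (norm_zetaTerm_le (by omega) hδ.le hδ' (le_of_lt hw.1)).trans ?_
      have : ‖w - 1‖ ≤ ‖z‖ + 2 := (norm_sub_le _ _).trans (by simp; linarith)
      gcongr
    exact ((this z hzV).differentiableAt (hVo.mem_nhds hzV)).differentiableWithinAt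
  refine (differentiable_riemannZeta₁.differentiableOn.analyticOnNhd hUo).eqOn_of_preconnected_of_eventuallyEq
    (hd.analyticOnNhd hUo) hUc (z₀ := 2) (by simp [hU]; linarith) ?_ hs
  filter_upwards [(isOpen_lt continuous_const continuous_re : IsOpen {s : ℂ | 1 < s.re}).mem_nhds
    (show (2 : ℂ) ∈ {s : ℂ | 1 < s.re} by simp)] with w hw
  exact riemannZeta₁_eq_of_one_lt_re hw

lemma norm_riemannZeta₁_sub_one_le {δ : ℝ} (hδ : 0 < δ) (hδ' : δ ≤ 1 / 2) :
    ∃ C > 0, ∀ s : ℂ, 1 - δ < s.re →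
      ‖riemannZeta₁ s - 1‖ ≤ C * ‖s - 1‖ * ‖s‖ ^ (2 * δ) := by
  have hS := summable_nat_add_one_rpow hδ
  refine ⟨2 * ∑' n : ℕ, ((n + 1 : ℕ) : ℝ) ^ (-(1 + δ)), ?_, fun s hs => ?_⟩
  · have := hS.tsum_pos (fun n => by positivity) 0 (by positivity)
    positivity
  · rw [riemannZeta₁_eq hδ hδ' hs, add_sub_cancel_left]
    refine (tsum_of_norm_bounded (((hS.mul_left (2 * ‖s‖ ^ (2 * δ))).mul_left ‖s - 1‖).hasSum)
      fun n => norm_zetaTerm_le (by omega) hδ.le hδ' hs.le).trans (le_of_eq ?_)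
    rw [tsum_mul_left, tsum_mul_left]; ring

end PrimeSums

namespace PrimeSums

open Complex Topology

lemma abs_im_le_norm_sub_one (s : ℂ) : |s.im| ≤ ‖s - 1‖ := by
  simpa using abs_im_le_norm (s - 1)

lemma ne_one_of_im {s : ℂ} (h : 0 < |s.im|) : s ≠ 1 := by
  rintro rfl; simp at h

lemma exists_norm_riemannZeta_le :
    ∃ C ≥ 1, ∀ s : ℂ, 63 / 64 < s.re → s.re ≤ 3 → 1 ≤ |s.im| →
      ‖riemannZeta s‖ ≤ C * |s.im| ^ (1 / 32 : ℝ) := by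
  obtain ⟨C, hC, h⟩ := norm_riemannZeta₁_sub_one_le (δ := 1 / 64) (by norm_num) (by norm_num)
  refine ⟨1 + 4 * C, by linarith, fun s h1 h2 h3 => ?_⟩
  have hs1 : s ≠ 1 := ne_one_of_im (by linarith)
  have hn : 1 ≤ ‖s - 1‖ := h3.trans (abs_im_le_norm_sub_one s)
  have hb := h s (by linarith)
  rw [show (2 * (1 / 64) : ℝ) = 1 / 32 by norm_num] at hb
  have hw : 1 ≤ |s.im| ^ (1 / 32 : ℝ) := Real.one_le_rpow h3 (by norm_num)
  have hs : ‖s‖ ^ (1 / 32 : ℝ) ≤ 4 * |s.im| ^ (1 / 32 : ℝ) := by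
    have h4 : ‖s‖ ≤ 4 * |s.im| := by
      refine (norm_le_abs_re_add_abs_im s).trans ?_
      rw [abs_of_pos (by linarith : 0 < s.re)]; linarith
    calc ‖s‖ ^ (1 / 32 : ℝ) ≤ (4 * |s.im|) ^ (1 / 32 : ℝ) := by gcongr
      _ = 4 ^ (1 / 32 : ℝ) * |s.im| ^ (1 / 32 : ℝ) := Real.mul_rpow (by norm_num) (abs_nonneg _)
      _ ≤ 4 ^ (1 : ℝ) * |s.im| ^ (1 / 32 : ℝ) := by gcongr <;> norm_num
      _ = _ := by simp
  rw [riemannZeta_eq_inv_sub_mul hs1, norm_mul, norm_inv, inv_mul_le_iff₀ (by linarith)]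
  have h5 : ‖riemannZeta₁ s‖ ≤ 1 + ‖riemannZeta₁ s - 1‖ := by
    simpa using norm_add_le 1 (riemannZeta₁ s - 1)
  have h6 : C * ‖s - 1‖ * ‖s‖ ^ (1 / 32 : ℝ) ≤ C * ‖s - 1‖ * (4 * |s.im| ^ (1 / 32 : ℝ)) := by
    gcongr
  have h7 : 1 ≤ ‖s - 1‖ * |s.im| ^ (1 / 32 : ℝ) := one_le_mul_of_one_le_of_one_le hn hw
  nlinarith

lemma rpow_le_two_mul {a b : ℝ} (ha : 0 ≤ a) (hb : 0 ≤ b) (h : a ≤ 2 * b) :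
    a ^ (1 / 32 : ℝ) ≤ 2 * b ^ (1 / 32 : ℝ) := by
  calc a ^ (1 / 32 : ℝ) ≤ (2 * b) ^ (1 / 32 : ℝ) := by gcongr
    _ = 2 ^ (1 / 32 : ℝ) * b ^ (1 / 32 : ℝ) := Real.mul_rpow (by norm_num) hb
    _ ≤ 2 ^ (1 : ℝ) * b ^ (1 / 32 : ℝ) := by gcongr <;> norm_num
    _ = _ := by simp

lemma exists_norm_deriv_riemannZeta_le :
    ∃ C ≥ 1, ∀ s : ℂ, 127 / 128 ≤ s.re → s.re ≤ 2 → 2 ≤ |s.im| →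
      ‖deriv riemannZeta s‖ ≤ C * |s.im| ^ (1 / 32 : ℝ) := by
  obtain ⟨C, hC, h⟩ := exists_norm_riemannZeta_le
  refine ⟨C * 2 * 256, by linarith, fun s h1 h2 h3 => ?_⟩
  have hball : ∀ z ∈ Metric.closedBall s (1 / 256),
      63 / 64 < z.re ∧ z.re ≤ 3 ∧ 1 ≤ |z.im| ∧ |z.im| ≤ 2 * |s.im| := by
    intro z hz
    rw [mem_closedBall_iff_norm] at hz
    have hr := abs_le.mp ((abs_re_le_norm (z - s)).trans hz)
    have hi := (abs_im_le_norm (z - s)).trans hz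
    rw [sub_re] at hr
    rw [sub_im] at hi
    have h4 := abs_sub_abs_le_abs_sub z.im s.im
    have h5 := abs_sub_abs_le_abs_sub s.im z.im
    rw [abs_sub_comm] at h5
    refine ⟨?_, ?_, ?_, ?_⟩ <;> linarith [hr.1, hr.2]
  have := Complex.norm_deriv_le_of_forall_mem_sphere_norm_le (c := s) (R := 1 / 256)
    (C := C * (2 * |s.im| ^ (1 / 32 : ℝ))) (f := riemannZeta) (by norm_num) ?_ ?_
  · refine this.trans (le_of_eq ?_); ring
  · refine DifferentiableOn.diffContOnCl_ball (U := Metric.closedBall s (1 / 256)) ?_ subset_rfl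
    intro z hz
    exact (differentiableAt_riemannZeta
      (ne_one_of_im (by linarith [(hball z hz).2.2.1]))).differentiableWithinAt
  · intro z hz
    obtain ⟨a, b, c, d⟩ := hball z (Metric.sphere_subset_closedBall hz)
    refine (h z a b c).trans ?_
    gcongr
    exact rpow_le_two_mul (abs_nonneg _) (abs_nonneg _) d

lemma norm_riemannZeta_product_ge_one {x : ℝ} (hx : 0 < x) (y : ℝ) :
    1 ≤ ‖riemannZeta (1 + x)‖ ^ 3 * ‖riemannZeta (1 + x + I * y)‖ ^ 4 *
      ‖riemannZeta (1 + x + 2 * I * y)‖ := by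
  have := DirichletCharacter.norm_LFunction_product_ge_one (1 : DirichletCharacter ℂ 1) hx y
  simp only [DirichletCharacter.LFunctionTrivChar, DirichletCharacter.LFunction_modOne_eq,
    norm_mul, norm_pow] at this
  exact this

lemma exists_norm_riemannZeta_real_le :
    ∃ C ≥ 1, ∀ x : ℝ, 0 < x → x ≤ 1 → ‖riemannZeta (1 + x)‖ ≤ C / x := by
  obtain ⟨C, hC, h⟩ := norm_riemannZeta₁_sub_one_le (δ := 1 / 2) (by norm_num) (by norm_num)
  refine ⟨1 + C * 2, by linarith, fun x h0 h1 => ?_⟩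
  have hs1 : (1 + x : ℂ) ≠ 1 := by
    simpa using h0.ne'
  have hb := h (1 + x) (by simp; linarith)
  have e1 : ‖(1 + x : ℂ)‖ ≤ 2 := by
    refine (norm_add_le _ _).trans ?_
    simp only [norm_one, norm_real, Real.norm_eq_abs, abs_of_pos h0]; linarith
  have e2 : ‖(1 + x : ℂ) - 1‖ = x := by simp [abs_of_pos h0]
  rw [riemannZeta_eq_inv_sub_mul hs1, norm_mul, norm_inv, e2, div_eq_inv_mul]
  gcongr
  have h5 : ‖riemannZeta₁ (1 + x)‖ ≤ 1 + ‖riemannZeta₁ (1 + x) - 1‖ := by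
    simpa using norm_add_le 1 (riemannZeta₁ (1 + x) - 1)
  rw [e2, show (2 * (1 / 2) : ℝ) = 1 by norm_num, Real.rpow_one] at hb
  have : C * x * ‖(1 + x : ℂ)‖ ≤ C * 1 * 2 := by gcongr
  linarith

lemma exists_cube_le_norm_riemannZeta_pow :
    ∃ C ≥ 1, ∀ s : ℂ, 1 < s.re → s.re ≤ 2 → 1 ≤ |s.im| →
      (s.re - 1) ^ 3 ≤ C * |s.im| ^ (1 / 32 : ℝ) * ‖riemannZeta s‖ ^ 4 := by
  obtain ⟨C, hC, h⟩ := exists_norm_riemannZeta_le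
  obtain ⟨D, hD, h'⟩ := exists_norm_riemannZeta_real_le
  refine ⟨D ^ 3 * (C * 2), one_le_mul_of_one_le_of_one_le (one_le_pow₀ hD) (by linarith),
    fun s h1 h2 h3 => ?_⟩
  have hx : 0 < s.re - 1 := by linarith
  have h4 := norm_riemannZeta_product_ge_one hx s.im
  have h5 := h' (s.re - 1) hx (by linarith)
  have e1 : (1 : ℂ) + ((s.re - 1 : ℝ) : ℂ) + I * s.im = s := by
    apply Complex.ext <;> simp
  have h6 := h (1 + ((s.re - 1 : ℝ) : ℂ) + 2 * I * s.im) (by simp; linarith) (by simp; linarith)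
    (by simp [abs_mul]; linarith)
  have e2 : ((1 : ℂ) + ((s.re - 1 : ℝ) : ℂ) + 2 * I * s.im).im = 2 * s.im := by simp
  rw [e2] at h6
  have h7 : |2 * s.im| ^ (1 / 32 : ℝ) ≤ 2 * |s.im| ^ (1 / 32 : ℝ) :=
    rpow_le_two_mul (abs_nonneg _) (abs_nonneg _) (by rw [abs_mul]; simp)
  rw [e1] at h4
  have h8 : 1 ≤ (D / (s.re - 1)) ^ 3 * ‖riemannZeta s‖ ^ 4 *
      (C * (2 * |s.im| ^ (1 / 32 : ℝ))) := by
    refine h4.trans ?_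
    gcongr
    exact h6.trans (by gcongr)
  calc (s.re - 1) ^ 3 = (s.re - 1) ^ 3 * 1 := by ring
    _ ≤ (s.re - 1) ^ 3 * ((D / (s.re - 1)) ^ 3 * ‖riemannZeta s‖ ^ 4 *
      (C * (2 * |s.im| ^ (1 / 32 : ℝ)))) := by gcongr
    _ = _ := by field_simp

lemma exists_le_norm_riemannZeta :
    ∃ c > 0, ∃ c₀ > 0, c₀ ≤ 1 / 128 ∧ ∀ s : ℂ, 2 ≤ |s.im| →
      1 - c₀ / (|s.im| ^ (1 / 32 : ℝ)) ^ 5 ≤ s.re → s.re ≤ 2 →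
      c / (|s.im| ^ (1 / 32 : ℝ)) ^ 4 ≤ ‖riemannZeta s‖ := by
  obtain ⟨C, hC, h⟩ := exists_norm_deriv_riemannZeta_le
  obtain ⟨D, hD, h'⟩ := exists_cube_le_norm_riemannZeta_pow
  set c₀ : ℝ := 1 / (D * (4 * C) ^ 4) with hc₀
  have hc₀p : 0 < c₀ := by positivity
  have hc₀l : c₀ ≤ 1 / 128 := by
    have : (128 : ℝ) ≤ D * (4 * C) ^ 4 := by
      calc (128 : ℝ) ≤ 1 * (4 * 1) ^ 4 := by norm_num
        _ ≤ _ := by gcongr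
    exact one_div_le_one_div_of_le (by norm_num) this
  refine ⟨2 * c₀ * C, by positivity, c₀, hc₀p, hc₀l, fun s h1 h2 h3 => ?_⟩
  set w := |s.im| ^ (1 / 32 : ℝ) with hw
  have hw1 : 1 ≤ w := Real.one_le_rpow (by linarith) (by norm_num)
  have hw0 : 0 < w := by linarith
  have hη : c₀ / w ^ 5 ≤ 1 / 128 := (div_le_self hc₀p.le (one_le_pow₀ hw1)).trans hc₀l
  have hη0 : 0 < c₀ / w ^ 5 := by positivity
  have far : ∀ z : ℂ, z.im = s.im → 1 + c₀ / w ^ 5 ≤ z.re → z.re ≤ 2 →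
      4 * c₀ * C / w ^ 4 ≤ ‖riemannZeta z‖ := by
    intro z hz1 hz2 hz3
    have h4 := h' z (by linarith) hz3 (by rw [hz1]; linarith)
    rw [hz1] at h4
    have h5 : (c₀ / w ^ 5) ^ 3 ≤ D * w * ‖riemannZeta z‖ ^ 4 := by
      refine le_trans ?_ h4
      gcongr; linarith
    refine le_of_pow_le_pow_left₀ (n := 4) (by norm_num) (norm_nonneg _) ?_
    have h6 : (4 * c₀ * C / w ^ 4) ^ 4 * (D * w) = (c₀ / w ^ 5) ^ 3 := by
      have : D * (4 * C) ^ 4 * c₀ = 1 := by rw [hc₀]; field_simp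
      field_simp
      linear_combination this
    have h7 : (4 * c₀ * C / w ^ 4) ^ 4 * (D * w) ≤ ‖riemannZeta z‖ ^ 4 * (D * w) := by
      rw [h6]; linarith
    exact le_of_mul_le_mul_right h7 (by positivity)
  rcases le_total (1 + c₀ / w ^ 5) s.re with h4 | h4
  · refine le_trans ?_ (far s rfl h4 h3)
    gcongr; norm_num
  · set z : ℂ := ⟨1 + c₀ / w ^ 5, s.im⟩ with hz
    have h5 := far z rfl le_rfl (by simp [hz]; linarith)
    have key := Convex.norm_image_sub_le_of_norm_deriv_le (𝕜 := ℂ) (f := riemannZeta)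
      (s := {v : ℂ | v.im = s.im} ∩ {v : ℂ | 127 / 128 ≤ v.re} ∩ {v : ℂ | v.re ≤ 2})
      (x := s) (y := z) (C := C * w)
      (fun v hv => differentiableAt_riemannZeta (ne_one_of_im (by
        have : v.im = s.im := hv.1.1
        rw [this]; linarith)))
      (fun v hv => by
        have e : v.im = s.im := hv.1.1
        have := h v hv.1.2 hv.2 (by rw [e]; exact h1)
        rwa [e] at this)
      (((convex_hyperplane (imLm.isLinear) _).inter (convex_halfSpace_re_ge _)).inter
        (convex_halfSpace_re_le _))
      ⟨⟨rfl, by simp only [Set.mem_ofPred_eq]; linarith⟩, h3⟩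
      ⟨⟨rfl, by simp only [Set.mem_ofPred_eq, hz]; linarith⟩, by
        simp only [Set.mem_ofPred_eq, hz]; linarith⟩
    have h6 : ‖z - s‖ ≤ 2 * (c₀ / w ^ 5) := by
      refine (norm_le_abs_re_add_abs_im _).trans ?_
      simp only [hz, sub_re, sub_im, sub_self, abs_zero, add_zero]
      rw [abs_of_nonneg (by linarith)]; linarith
    have h7 : ‖riemannZeta z‖ - ‖riemannZeta s‖ ≤ C * w * (2 * (c₀ / w ^ 5)) :=
      (norm_sub_norm_le _ _).trans (key.trans (by gcongr))
    have h8 : C * w * (2 * (c₀ / w ^ 5)) = 2 * c₀ * C / w ^ 4 := by field_simp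
    have h9 : 4 * c₀ * C / w ^ 4 = 2 * c₀ * C / w ^ 4 + 2 * c₀ * C / w ^ 4 := by ring
    linarith

lemma exists_norm_logDeriv_riemannZeta_le :
    ∃ C > 0, ∃ c₀ > 0, c₀ ≤ 1 / 128 ∧ ∀ s : ℂ, 2 ≤ |s.im| →
      1 - c₀ / (|s.im| ^ (1 / 32 : ℝ)) ^ 5 ≤ s.re → s.re ≤ 2 →
      riemannZeta s ≠ 0 ∧
      ‖deriv riemannZeta s / riemannZeta s‖ ≤ C * (|s.im| ^ (1 / 32 : ℝ)) ^ 5 := by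
  obtain ⟨C, hC, h⟩ := exists_norm_deriv_riemannZeta_le
  obtain ⟨c, hc, c₀, hc₀, hc₀l, h'⟩ := exists_le_norm_riemannZeta
  refine ⟨C / c, by positivity, c₀, hc₀, hc₀l, fun s h1 h2 h3 => ?_⟩
  have h4 := h' s h1 h2 h3
  set w := |s.im| ^ (1 / 32 : ℝ) with hw
  have hw1 : 1 ≤ w := Real.one_le_rpow (by linarith) (by norm_num)
  have hη : c₀ / w ^ 5 ≤ 1 / 128 := (div_le_self hc₀.le (one_le_pow₀ hw1)).trans hc₀l
  have h5 := h s (by linarith) h3 h1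
  have h6 : 0 < c / w ^ 4 := by positivity
  refine ⟨norm_pos_iff.mp (h6.trans_le h4), ?_⟩
  rw [norm_div]
  calc _ ≤ (C * w) / (c / w ^ 4) := by gcongr
    _ = _ := by field_simp

end PrimeSums

namespace PrimeSums

open Complex Topology

/-- The function `-(logDeriv ζ s + 1/(s - 1)) / (s (s + 1))`, with the singularity at `1` removed. -/
noncomputable def smoothedLogDeriv (s : ℂ) : ℂ :=
  -(deriv riemannZeta₁ s / riemannZeta₁ s) / (s * (s + 1))

lemma riemannZeta₁_eq_mul {s : ℂ} (hs : s ≠ 1) : riemannZeta₁ s = (s - 1) * riemannZeta s := by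
  rw [riemannZeta_eq_inv_sub_mul hs, ← mul_assoc, mul_inv_cancel₀ (sub_ne_zero.mpr hs), one_mul]

lemma riemannZeta₁_ne_zero {s : ℂ} (hs : 1 ≤ s.re) : riemannZeta₁ s ≠ 0 := by
  by_cases h : s = 1
  · subst h; simp
  · rw [riemannZeta₁_eq_mul h]
    exact mul_ne_zero (sub_ne_zero.mpr h) (riemannZeta_ne_zero_of_one_le_re hs)

lemma deriv_riemannZeta₁_div {s : ℂ} (hs : s ≠ 1) (h0 : riemannZeta s ≠ 0) :
    deriv riemannZeta₁ s / riemannZeta₁ s = deriv riemannZeta s / riemannZeta s + 1 / (s - 1) := by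
  have h1 : riemannZeta₁ =ᶠ[𝓝 s] fun z => (z - 1) * riemannZeta z := by
    filter_upwards [isOpen_ne.mem_nhds hs] with z hz
    exact riemannZeta₁_eq_mul hz
  have h2 : HasDerivAt (fun z => (z - 1) * riemannZeta z)
      (1 * riemannZeta s + (s - 1) * deriv riemannZeta s) s :=
    ((hasDerivAt_id s).sub_const 1).mul (differentiableAt_riemannZeta hs).hasDerivAt
  rw [h1.deriv_eq, h2.deriv, riemannZeta₁_eq_mul hs]
  have := sub_ne_zero.mpr hs
  field_simp
  ring

lemma differentiableAt_smoothedLogDeriv {s : ℂ} (hs : 0 < s.re) (h : riemannZeta₁ s ≠ 0) :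
    DifferentiableAt ℂ smoothedLogDeriv s := by
  have h0 : s ≠ 0 := by rintro rfl; simp at hs
  have h1 : s + 1 ≠ 0 := by
    intro h
    have := congrArg re h
    simp at this; linarith
  refine DifferentiableAt.div (DifferentiableAt.neg (DifferentiableAt.div ?_
    (differentiable_riemannZeta₁ s) h)) (by fun_prop) (mul_ne_zero h0 h1)
  exact ((differentiable_riemannZeta₁.contDiff (n := 2)).differentiable_deriv_two) s

lemma isOpen_re_pos_riemannZeta₁_ne_zero :
    IsOpen {s : ℂ | 0 < s.re ∧ riemannZeta₁ s ≠ 0} :=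
  (isOpen_lt continuous_const continuous_re).inter
    (isOpen_ne_fun differentiable_riemannZeta₁.continuous continuous_const)

lemma analyticAt_smoothedLogDeriv {s : ℂ} (hs : 1 ≤ s.re) : AnalyticAt ℂ smoothedLogDeriv s := by
  refine DifferentiableOn.analyticAt (s := {s : ℂ | 0 < s.re ∧ riemannZeta₁ s ≠ 0})
    (fun z hz => (differentiableAt_smoothedLogDeriv hz.1 hz.2).differentiableWithinAt)
    (isOpen_re_pos_riemannZeta₁_ne_zero.mem_nhds ⟨?_, riemannZeta₁_ne_zero hs⟩)
  linarith

lemma exists_norm_iteratedDeriv_le_of_large :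
    ∃ K > 0, ∀ s : ℂ, 1 ≤ s.re → s.re ≤ 3 / 2 → 3 ≤ |s.im| →
      ‖iteratedDeriv 4 smoothedLogDeriv s‖ ≤ K * |s.im| ^ (-39 / 32 : ℝ) := by
  obtain ⟨C, hC, c₀, hc₀, hc₀l, h⟩ := exists_norm_logDeriv_riemannZeta_le
  refine ⟨24 * ((C * 32 + 1) * 4) * (64 / c₀) ^ 4, by positivity, fun s h1 h2 h3 => ?_⟩
  set w := |s.im| ^ (1 / 32 : ℝ) with hw
  have hw1 : 1 ≤ w := Real.one_le_rpow (by linarith) (by norm_num)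
  have hw0 : 0 < w := by linarith
  set r := c₀ / (64 * w ^ 5) with hr
  have hr0 : 0 < r := by positivity
  have hr1 : r ≤ 1 / 128 := by
    refine (div_le_self hc₀.le ?_).trans hc₀l
    have := one_le_pow₀ (n := 5) hw1
    linarith
  have hball : ∀ z ∈ Metric.closedBall s r, riemannZeta₁ z ≠ 0 ∧ 0 < z.re ∧
      ‖smoothedLogDeriv z‖ ≤ (C * 32 + 1) * w ^ 5 * (4 / |s.im| ^ 2) := by
    intro z hz
    rw [mem_closedBall_iff_norm] at hz
    have hre := abs_le.mp ((abs_re_le_norm (z - s)).trans hz)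
    have hi := (abs_im_le_norm (z - s)).trans hz
    rw [sub_re] at hre
    rw [sub_im] at hi
    have h4 := abs_sub_abs_le_abs_sub z.im s.im
    have h5 := abs_sub_abs_le_abs_sub s.im z.im
    rw [abs_sub_comm] at h5
    have hw' : |z.im| ^ (1 / 32 : ℝ) ≤ 2 * w :=
      rpow_le_two_mul (abs_nonneg _) (abs_nonneg _) (by linarith)
    have hz2 : 2 ≤ |z.im| := by linarith
    have hz0 : 0 < |z.im| ^ (1 / 32 : ℝ) := Real.rpow_pos_of_pos (by linarith) _
    have hw5 : (|z.im| ^ (1 / 32 : ℝ)) ^ 5 ≤ 32 * w ^ 5 := by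
      calc _ ≤ (2 * w) ^ 5 := by gcongr
        _ = _ := by ring
    have hrle : r ≤ c₀ / (|z.im| ^ (1 / 32 : ℝ)) ^ 5 := by
      rw [hr]
      have : 0 < w ^ 5 := by positivity
      gcongr
      linarith
    obtain ⟨h6, h7⟩ := h z hz2 (by linarith [hre.1]) (by linarith [hre.2])
    have hz1 : z ≠ 1 := ne_one_of_im (by linarith)
    refine ⟨?_, by linarith [hre.1], ?_⟩
    · rw [riemannZeta₁_eq_mul hz1]
      exact mul_ne_zero (sub_ne_zero.mpr hz1) h6
    · rw [smoothedLogDeriv, norm_div, norm_neg, deriv_riemannZeta₁_div hz1 h6, div_eq_mul_inv]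
      have hz1' : 1 ≤ ‖z - 1‖ := le_trans (by linarith) (abs_im_le_norm_sub_one z)
      have h8 : ‖deriv riemannZeta z / riemannZeta z + 1 / (z - 1)‖ ≤ (C * 32 + 1) * w ^ 5 := by
        refine (norm_add_le _ _).trans ?_
        have : ‖1 / (z - 1)‖ ≤ 1 := by
          rw [norm_div, norm_one]
          exact div_le_one_of_le₀ hz1' (by positivity)
        have h9 := one_le_pow₀ (n := 5) hw1
        have : C * (|z.im| ^ (1 / 32 : ℝ)) ^ 5 ≤ C * (32 * w ^ 5) := by gcongr
        linarith
      have h10 : ‖z * (z + 1)‖⁻¹ ≤ 4 / |s.im| ^ 2 := by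
        have a1 : |s.im| / 2 ≤ ‖z‖ := le_trans (by linarith) (abs_im_le_norm z)
        have a2 : |s.im| / 2 ≤ ‖z + 1‖ := by
          refine le_trans ?_ (abs_im_le_norm (z + 1))
          simp only [add_im, one_im, add_zero]; linarith
        rw [norm_mul]
        have a3 : 0 < |s.im| / 2 := by linarith
        calc (‖z‖ * ‖z + 1‖)⁻¹ ≤ (|s.im| / 2 * (|s.im| / 2))⁻¹ := by gcongr
          _ = _ := by field_simp; norm_num
      gcongr
  have key := Complex.norm_iteratedDeriv_le_of_forall_mem_sphere_norm_le (c := s) (R := r)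
    (C := (C * 32 + 1) * w ^ 5 * (4 / |s.im| ^ 2)) (f := smoothedLogDeriv) 4 hr0
    (DifferentiableOn.diffContOnCl_ball (U := Metric.closedBall s r)
      (fun z hz => (differentiableAt_smoothedLogDeriv (hball z hz).2.1
        (hball z hz).1).differentiableWithinAt) subset_rfl)
    (fun z hz => (hball z (Metric.sphere_subset_closedBall hz)).2.2)
  refine key.trans (le_of_eq ?_)
  have hT : 0 < |s.im| := by linarith
  have hw25 : |s.im| ^ (-39 / 32 : ℝ) = w ^ 25 / |s.im| ^ 2 := by
    rw [hw, ← Real.rpow_natCast, ← Real.rpow_mul hT.le, ← Real.rpow_natCast |s.im| 2,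
      ← Real.rpow_sub hT]
    norm_num
  rw [hw25, hr, show ((Nat.factorial 4 : ℕ) : ℝ) = 24 by norm_num [Nat.factorial]]
  field_simp

lemma exists_norm_iteratedDeriv_le_of_small :
    ∃ K > 0, ∀ s : ℂ, 1 ≤ s.re → s.re ≤ 3 / 2 → |s.im| ≤ 3 →
      ‖iteratedDeriv 4 smoothedLogDeriv s‖ ≤ K := by
  have hc : IsCompact (Set.Icc (1 : ℝ) (3 / 2) ×ℂ Set.Icc (-3 : ℝ) 3) :=
    isCompact_Icc.reProdIm isCompact_Icc
  have hcont : ContinuousOn (iteratedDeriv 4 smoothedLogDeriv)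
      (Set.Icc (1 : ℝ) (3 / 2) ×ℂ Set.Icc (-3 : ℝ) 3) := by
    intro s hs
    have h1 : AnalyticAt ℂ smoothedLogDeriv s := analyticAt_smoothedLogDeriv hs.1.1
    rw [iteratedDeriv_eq_iterate]
    exact (h1.iterated_deriv 4).continuousAt.continuousWithinAt
  obtain ⟨K, hK⟩ := hc.exists_bound_of_continuousOn hcont
  refine ⟨max K 1, by positivity, fun s h1 h2 h3 => (hK s ?_).trans (le_max_left _ _)⟩
  exact ⟨⟨h1, h2⟩, abs_le.mp h3⟩

lemma exists_norm_iteratedDeriv_le :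
    ∃ K > 0, ∀ s : ℂ, 1 ≤ s.re → s.re ≤ 3 / 2 →
      ‖iteratedDeriv 4 smoothedLogDeriv s‖ ≤ K * (1 + |s.im|) ^ (-39 / 32 : ℝ) := by
  obtain ⟨K, hK, h⟩ := exists_norm_iteratedDeriv_le_of_large
  obtain ⟨K', hK', h'⟩ := exists_norm_iteratedDeriv_le_of_small
  refine ⟨K * 2 ^ (39 / 32 : ℝ) + K' * 4 ^ (39 / 32 : ℝ), by positivity, fun s h1 h2 => ?_⟩
  have hpos : 0 < (1 + |s.im|) ^ (-39 / 32 : ℝ) := by positivity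
  rw [add_mul]
  rcases le_total 3 |s.im| with h3 | h3
  · refine (h s h1 h2 h3).trans ?_
    have e : |s.im| ^ (-39 / 32 : ℝ) ≤ 2 ^ (39 / 32 : ℝ) * (1 + |s.im|) ^ (-39 / 32 : ℝ) := by
      have : ((1 + |s.im|) / 2) ^ (-39 / 32 : ℝ) =
          2 ^ (39 / 32 : ℝ) * (1 + |s.im|) ^ (-39 / 32 : ℝ) := by
        rw [Real.div_rpow (by positivity) (by norm_num), div_eq_mul_inv, ← Real.rpow_neg (by norm_num)]
        norm_num [mul_comm]
      rw [← this]
      exact Real.rpow_le_rpow_of_nonpos (by positivity) (by linarith) (by norm_num)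
    have : 0 ≤ K' * 4 ^ (39 / 32 : ℝ) * (1 + |s.im|) ^ (-39 / 32 : ℝ) := by positivity
    nlinarith
  · refine (h' s h1 h2 h3).trans ?_
    have e : 1 ≤ 4 ^ (39 / 32 : ℝ) * (1 + |s.im|) ^ (-39 / 32 : ℝ) := by
      have : (4 : ℝ) ^ (-39 / 32 : ℝ) ≤ (1 + |s.im|) ^ (-39 / 32 : ℝ) :=
        Real.rpow_le_rpow_of_nonpos (by positivity) (by linarith) (by norm_num)
      calc (1 : ℝ) = 4 ^ (39 / 32 : ℝ) * 4 ^ (-39 / 32 : ℝ) := by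
            rw [← Real.rpow_add (by norm_num)]; norm_num
        _ ≤ _ := by gcongr
    have : 0 ≤ K * 2 ^ (39 / 32 : ℝ) * (1 + |s.im|) ^ (-39 / 32 : ℝ) := by positivity
    nlinarith

lemma iteratedDeriv_vertical {f : ℂ → ℂ} {a : ℝ} (hf : ∀ s : ℂ, s.re = a → AnalyticAt ℂ f s)
    (c : ℝ) (n : ℕ) (t : ℝ) :
    iteratedDeriv n (fun t : ℝ => f (a + c * t * I)) t =
      (c * I) ^ n * iteratedDeriv n f (a + c * t * I) := by
  induction n generalizing t with
  | zero => simp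
  | succ n ih =>
    rw [iteratedDeriv_succ, funext ih, iteratedDeriv_succ]
    have h1 : AnalyticAt ℂ (iteratedDeriv n f) (a + c * t * I) := by
      rw [iteratedDeriv_eq_iterate]
      exact (hf _ (by simp)).iterated_deriv n
    have h2 : HasDerivAt (fun t : ℝ => (a + c * t * I : ℂ)) (c * I) t := by
      have := ((Complex.ofRealCLM.hasDerivAt (x := t)).const_mul (c : ℂ)).mul_const I |>.const_add (a : ℂ)
      simpa using this
    have h3 := (h1.differentiableAt.hasDerivAt.comp_of_eq t h2 rfl).const_mul ((c * I : ℂ) ^ n)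
    refine Eq.trans h3.deriv ?_
    ring

end PrimeSums

namespace PrimeSums

open Complex Topology MeasureTheory
open scoped ArithmeticFunction.vonMangoldt

/-- The integrated Chebyshev function `∑ n ≤ x, Λ n * (x - n)`. -/
noncomputable def psiOne (x : ℝ) : ℝ := ∑ n ∈ Icc 1 ⌊x⌋₊, Λ n * (x - n)

lemma psi_eq_sum_Icc_one (x : ℝ) : Chebyshev.psi x = ∑ n ∈ Icc 1 ⌊x⌋₊, Λ n := rfl

lemma psiOne_eq_sum_max {x : ℝ} (hx : 0 ≤ x) {N : ℕ} (hN : ⌊x⌋₊ ≤ N) :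
    psiOne x = ∑ n ∈ Icc 1 N, Λ n * max (x - n) 0 := by
  rw [psiOne]
  have hsub : Icc 1 ⌊x⌋₊ ⊆ Icc 1 N := Icc_subset_Icc_right hN
  rw [← sum_subset hsub]
  · refine sum_congr rfl fun n hn ↦ ?_
    rw [max_eq_left]
    have := (Nat.le_floor_iff hx).mp (mem_Icc.mp hn).2
    linarith
  · intro n hn hn'
    rw [max_eq_right, mul_zero]
    have : ⌊x⌋₊ < n := by
      simp only [mem_Icc] at hn hn'
      omega
    have := (Nat.floor_lt hx).mp this
    linarith

lemma psiOne_nonneg {x : ℝ} (hx : 0 ≤ x) : 0 ≤ psiOne x := by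
  rw [psiOne_eq_sum_max hx le_rfl]
  exact sum_nonneg fun n _ ↦
    mul_nonneg ArithmeticFunction.vonMangoldt_nonneg (le_max_right _ _)

lemma psiOne_le (x : ℝ) : psiOne x ≤ x * Chebyshev.psi x := by
  rw [psiOne, psi_eq_sum_Icc_one, mul_sum]
  refine sum_le_sum fun n _ ↦ ?_
  have := ArithmeticFunction.vonMangoldt_nonneg (n := n)
  nlinarith [(Nat.cast_nonneg n : (0:ℝ) ≤ n)]

lemma psiOne_eq_add {x y : ℝ} (hxy : x ≤ y) :
    psiOne y = ∑ n ∈ Icc 1 ⌊x⌋₊, Λ n * (y - n) + ∑ n ∈ Ioc ⌊x⌋₊ ⌊y⌋₊, Λ n * (y - n) := by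
  rw [psiOne]
  exact (sum_Ioc_consecutive (fun n : ℕ ↦ Λ n * (y - n)) (Nat.zero_le _)
    (Nat.floor_le_floor hxy)).symm

lemma mul_psi_le_psiOne_sub {x y : ℝ} (hy : 0 ≤ y) (hxy : x ≤ y) :
    (y - x) * Chebyshev.psi x ≤ psiOne y - psiOne x := by
  rw [psiOne_eq_add hxy, psiOne, psi_eq_sum_Icc_one, mul_sum]
  have h : ∀ n ∈ Ioc ⌊x⌋₊ ⌊y⌋₊, 0 ≤ Λ n * (y - n) := fun n hn ↦ by
    have := (Nat.le_floor_iff hy).mp (mem_Ioc.mp hn).2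
    exact mul_nonneg ArithmeticFunction.vonMangoldt_nonneg (by linarith)
  have h2 : ∑ n ∈ Icc 1 ⌊x⌋₊, Λ n * (y - n) - ∑ n ∈ Icc 1 ⌊x⌋₊, Λ n * (x - n)
      = ∑ n ∈ Icc 1 ⌊x⌋₊, (y - x) * Λ n := by
    rw [← sum_sub_distrib]; exact sum_congr rfl fun n _ ↦ by ring
  linarith [sum_nonneg h]

lemma psiOne_sub_le_mul_psi {x y : ℝ} (hx : 0 ≤ x) (hxy : x ≤ y) :
    psiOne y - psiOne x ≤ (y - x) * Chebyshev.psi y := by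
  have hy := hx.trans hxy
  have h3 : Chebyshev.psi y = ∑ n ∈ Icc 1 ⌊x⌋₊, Λ n + ∑ n ∈ Ioc ⌊x⌋₊ ⌊y⌋₊, Λ n :=
    (sum_Ioc_consecutive (fun n : ℕ ↦ Λ n) (Nat.zero_le _) (Nat.floor_le_floor hxy)).symm
  rw [psiOne_eq_add hxy, psiOne, h3, mul_add, mul_sum, mul_sum]
  have h : ∑ n ∈ Ioc ⌊x⌋₊ ⌊y⌋₊, Λ n * (y - n) ≤ ∑ n ∈ Ioc ⌊x⌋₊ ⌊y⌋₊, (y - x) * Λ n :=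
    sum_le_sum fun n hn ↦ by
      have := (Nat.floor_lt hx).mp (mem_Ioc.mp hn).1
      have h0 := ArithmeticFunction.vonMangoldt_nonneg (n := n)
      nlinarith
  have h2 : ∑ n ∈ Icc 1 ⌊x⌋₊, Λ n * (y - n) - ∑ n ∈ Icc 1 ⌊x⌋₊, Λ n * (x - n)
      = ∑ n ∈ Icc 1 ⌊x⌋₊, (y - x) * Λ n := by
    rw [← sum_sub_distrib]; exact sum_congr rfl fun n _ ↦ by ring
  linarith

lemma continuousOn_psiOne : ContinuousOn psiOne (Set.Ici 0) := by
  intro x hx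
  have hx : 0 ≤ x := hx
  have h : ∀ᶠ y in 𝓝[Set.Ici 0] x,
      psiOne y = ∑ n ∈ Icc 1 (⌊x⌋₊ + 1), Λ n * max (y - n) 0 := by
    have h1 : ∀ᶠ y in 𝓝[Set.Ici 0] x, y < x + 1 :=
      mem_nhdsWithin_of_mem_nhds (Iio_mem_nhds (by linarith))
    filter_upwards [h1, self_mem_nhdsWithin] with y hy hy0
    refine psiOne_eq_sum_max hy0 ?_
    have := Nat.floor_le_floor hy.le
    rwa [Nat.floor_add_one hx] at this
  refine ContinuousWithinAt.congr_of_eventuallyEq ?_ h ?_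
  · exact Continuous.continuousWithinAt (by fun_prop)
  · exact psiOne_eq_sum_max hx (Nat.le_succ _)

lemma measurable_sum_floor (f : ℕ → ℂ) : Measurable fun t : ℝ ↦ ∑ k ∈ Icc 1 ⌊t⌋₊, f k :=
  (measurable_from_nat (f := fun N ↦ ∑ k ∈ Icc 1 N, f k)).comp Nat.measurable_floor

lemma integrableOn_sum_floor_mul_cpow {f : ℕ → ℂ} {C a : ℝ} {s : ℂ}
    (hf : ∀ t : ℝ, 1 ≤ t → ‖∑ k ∈ Icc 1 ⌊t⌋₊, f k‖ ≤ C * t ^ a) (hs : a < s.re) :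
    IntegrableOn (fun t : ℝ ↦ (∑ k ∈ Icc 1 ⌊t⌋₊, f k) * (t : ℂ) ^ (-(s + 1))) (Set.Ioi 1) := by
  have hg : IntegrableOn (fun t : ℝ ↦ C * t ^ (a - s.re - 1)) (Set.Ioi 1) :=
    (integrableOn_Ioi_rpow_of_lt (by linarith) one_pos).const_mul C
  refine hg.mono' ?_ ?_
  · refine AEStronglyMeasurable.mul (measurable_sum_floor f).aestronglyMeasurable ?_
    refine ContinuousOn.aestronglyMeasurable (fun t ht ↦ ?_) measurableSet_Ioi
    have ht : (1:ℝ) < t := ht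
    exact (Complex.continuousAt_ofReal_cpow_const t _
      (Or.inr (by linarith))).continuousWithinAt
  · refine (ae_restrict_iff' measurableSet_Ioi).mpr (Eventually.of_forall fun t ht ↦ ?_)
    have ht : (1:ℝ) < t := ht
    rw [norm_mul, Complex.norm_cpow_eq_rpow_re_of_pos (by linarith)]
    calc _ ≤ C * t ^ a * t ^ (-(s + 1)).re := by gcongr; exact hf t ht.le
      _ = _ := by
        rw [mul_assoc, ← Real.rpow_add (by linarith)]; congr 2; simp; ring

lemma norm_sum_vonMangoldt_le {t : ℝ} (ht : 1 ≤ t) :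
    ‖∑ k ∈ Icc 1 ⌊t⌋₊, (Λ k : ℂ)‖ ≤ (Real.log 4 + 4) * t ^ (1:ℝ) := by
  rw [← ofReal_sum, ← psi_eq_sum_Icc_one, norm_real, Real.norm_of_nonneg (Chebyshev.psi_nonneg _),
    Real.rpow_one]
  exact Chebyshev.psi_le_const_mul_self (by linarith)

lemma norm_sum_mul_vonMangoldt_le {t : ℝ} (ht : 1 ≤ t) :
    ‖∑ k ∈ Icc 1 ⌊t⌋₊, ((k * Λ k : ℝ) : ℂ)‖ ≤ (Real.log 4 + 4) * t ^ (2:ℝ) := by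
  have h0 : ∀ k ∈ Icc 1 ⌊t⌋₊, (0:ℝ) ≤ k * Λ k := fun k _ ↦
    mul_nonneg (Nat.cast_nonneg k) ArithmeticFunction.vonMangoldt_nonneg
  rw [← ofReal_sum, norm_real, Real.norm_of_nonneg (sum_nonneg h0)]
  calc _ ≤ ∑ k ∈ Icc 1 ⌊t⌋₊, t * Λ k := sum_le_sum fun k hk ↦
        mul_le_mul_of_nonneg_right ((Nat.le_floor_iff (by linarith)).mp (mem_Icc.mp hk).2)
          ArithmeticFunction.vonMangoldt_nonneg
    _ = t * Chebyshev.psi t := by rw [← mul_sum, psi_eq_sum_Icc_one]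
    _ ≤ t * ((Real.log 4 + 4) * t) := by
      gcongr; exact Chebyshev.psi_le_const_mul_self (by linarith)
    _ = _ := by rw [Real.rpow_two]; ring

lemma isBigO_of_floor_bound {f : ℕ → ℝ} {C a : ℝ}
    (h : ∀ t : ℝ, 1 ≤ t → ‖∑ k ∈ Icc 1 ⌊t⌋₊, (f k : ℂ)‖ ≤ C * t ^ a) :
    (fun n ↦ ∑ k ∈ Icc 1 n, f k) =O[atTop] fun n ↦ (n : ℝ) ^ a := by
  refine Asymptotics.IsBigO.of_bound C ?_
  filter_upwards [eventually_ge_atTop 1] with n hn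
  have := h n (by exact_mod_cast hn)
  rw [Nat.floor_natCast, ← ofReal_sum, norm_real] at this
  rwa [Real.norm_of_nonneg (Real.rpow_nonneg (Nat.cast_nonneg n) a)]

lemma LSeries_mul_vonMangoldt (s : ℂ) :
    LSeries (fun n ↦ ((n * Λ n : ℝ) : ℂ)) (s + 1) = LSeries (fun n ↦ (Λ n : ℂ)) s := by
  refine tsum_congr fun n ↦ ?_
  rcases eq_or_ne n 0 with rfl | hn
  · simp
  · have : (n : ℂ) ≠ 0 := by exact_mod_cast hn
    rw [LSeries.term_of_ne_zero hn, LSeries.term_of_ne_zero hn, cpow_add _ _ this, cpow_one]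
    push_cast
    field_simp

lemma integral_psiOne {s : ℂ} (hs : 1 < s.re) :
    IntegrableOn (fun t : ℝ ↦ (psiOne t : ℂ) * (t : ℂ) ^ (-(s + 2))) (Set.Ioi 1) ∧
    ∫ t in Set.Ioi (1:ℝ), (psiOne t : ℂ) * (t : ℂ) ^ (-(s + 2)) =
      (-deriv riemannZeta s / riemannZeta s) / (s * (s + 1)) := by
  have hs0 : s ≠ 0 := by rintro rfl; simp at hs; linarith
  have hs1 : s + 1 ≠ 0 := by
    intro h
    have : s.re + 1 = 0 := by simpa using congrArg Complex.re h
    linarith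
  have i1 := integrableOn_sum_floor_mul_cpow (f := fun k ↦ (Λ k : ℂ)) (s := s)
    (fun t ht ↦ norm_sum_vonMangoldt_le ht) hs
  have i2 := integrableOn_sum_floor_mul_cpow (f := fun k ↦ ((k * Λ k : ℝ) : ℂ)) (s := s + 1)
    (fun t ht ↦ norm_sum_mul_vonMangoldt_le ht) (by simp; linarith)
  have e1 := LSeries_eq_mul_integral_of_nonneg (fun k ↦ Λ k) (r := 1) (s := s) zero_le_one hs
    (isBigO_of_floor_bound fun t ht ↦ norm_sum_vonMangoldt_le ht)
    (fun n ↦ ArithmeticFunction.vonMangoldt_nonneg)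
  have e2 := LSeries_eq_mul_integral_of_nonneg (fun k ↦ (k * Λ k : ℝ)) (r := 2) (s := s + 1)
    zero_le_two (by simp; linarith)
    (isBigO_of_floor_bound fun t ht ↦ norm_sum_mul_vonMangoldt_le ht)
    (fun n ↦ mul_nonneg (Nat.cast_nonneg n) ArithmeticFunction.vonMangoldt_nonneg)
  rw [LSeries_mul_vonMangoldt] at e2
  have e3 := ArithmeticFunction.LSeries_vonMangoldt_eq_deriv_riemannZeta_div hs
  have hE : Set.EqOn (fun t : ℝ ↦ (psiOne t : ℂ) * (t : ℂ) ^ (-(s + 2)))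
      (fun t : ℝ ↦ (∑ k ∈ Icc 1 ⌊t⌋₊, (Λ k : ℂ)) * (t : ℂ) ^ (-(s + 1)) -
        (∑ k ∈ Icc 1 ⌊t⌋₊, ((k * Λ k : ℝ) : ℂ)) * (t : ℂ) ^ (-(s + 1 + 1))) (Set.Ioi 1) := by
    intro t ht
    have ht : (1:ℝ) < t := ht
    have ht0 : (t : ℂ) ≠ 0 := by exact_mod_cast (by linarith : t ≠ 0)
    have hp : (t : ℂ) ^ (-(s + 1)) = t * (t : ℂ) ^ (-(s + 2)) := by
      rw [show -(s + 1) = 1 + -(s + 2) by ring, cpow_add _ _ ht0, cpow_one]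
    simp only [psiOne]
    rw [hp, show s + 1 + 1 = s + 2 by ring, ← mul_assoc, ← sub_mul, sum_mul, ← sum_sub_distrib]
    congr 1
    push_cast
    exact sum_congr rfl fun n _ ↦ by ring
  refine ⟨(integrableOn_congr_fun hE measurableSet_Ioi).mpr (i1.sub i2), ?_⟩
  rw [setIntegral_congr_fun measurableSet_Ioi hE, integral_sub i1 i2, ← e3]
  rw [e3] at e1 e2 ⊢
  set I₁ := ∫ t in Set.Ioi (1:ℝ), (∑ k ∈ Icc 1 ⌊t⌋₊, (Λ k : ℂ)) * (t : ℂ) ^ (-(s + 1))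
  set I₂ := ∫ t in Set.Ioi (1:ℝ),
    (∑ k ∈ Icc 1 ⌊t⌋₊, ((k * Λ k : ℝ) : ℂ)) * (t : ℂ) ^ (-(s + 1 + 1))
  rw [eq_div_iff (mul_ne_zero hs0 hs1)]
  linear_combination (-(s+1)) * e1 + s * e2

end PrimeSums

namespace PrimeSums

open Complex Topology MeasureTheory

/-- The normalized error term of `psiOne` on a logarithmic scale. -/
noncomputable def psiOneError (u : ℝ) : ℝ :=
  Real.exp (-2 * u) * (psiOne (Real.exp u) - (Real.exp u - 1) ^ 2 / 2)

lemma continuous_psiOneError : Continuous psiOneError := by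
  have : Continuous fun u ↦ psiOne (Real.exp u) :=
    continuousOn_psiOne.comp_continuous Real.continuous_exp fun u ↦ (Real.exp_pos u).le
  unfold psiOneError
  fun_prop

lemma psiOneError_zero : psiOneError 0 = 0 := by
  simp [psiOneError, psiOne]

lemma abs_psiOneError_le {u : ℝ} (hu : 0 ≤ u) : |psiOneError u| ≤ Real.log 4 + 5 := by
  have he : 1 ≤ Real.exp u := Real.one_le_exp hu
  have h0 := psiOne_nonneg (Real.exp_pos u).le
  have h1 := (psiOne_le (Real.exp u)).trans
    (mul_le_mul_of_nonneg_left (Chebyshev.psi_le_const_mul_self (Real.exp_pos u).le)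
      (Real.exp_pos u).le)
  have h2 : Real.exp (-2 * u) = (Real.exp u ^ 2)⁻¹ := by
    rw [← Real.exp_nat_mul, ← Real.exp_neg]; congr 1; push_cast; ring
  have hl : 0 ≤ Real.log 4 := Real.log_nonneg (by norm_num)
  rw [psiOneError, abs_mul, Real.abs_exp, h2, inv_mul_le_iff₀ (by positivity), abs_le]
  constructor <;> nlinarith [mul_nonneg hl (sq_nonneg (Real.exp u))]

lemma image_exp_Ioi_zero : Real.exp '' Set.Ioi 0 = Set.Ioi 1 := by
  ext x
  simp only [Set.mem_image, Set.mem_Ioi]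
  constructor
  · rintro ⟨u, hu, rfl⟩; exact Real.one_lt_exp_iff.mpr hu
  · intro hx; exact ⟨Real.log x, Real.log_pos hx, Real.exp_log (by linarith)⟩

lemma ofReal_exp_cpow (u : ℝ) (z : ℂ) : ((Real.exp u : ℝ) : ℂ) ^ z = cexp (z * u) := by
  rw [cpow_def_of_ne_zero (by exact_mod_cast (Real.exp_pos u).ne'),
    ← ofReal_log (Real.exp_pos u).le, Real.log_exp, mul_comm]

lemma integral_psiOne_exp {s : ℂ} (hs : 1 < s.re) :
    IntegrableOn (fun u : ℝ ↦ (psiOne (Real.exp u) : ℂ) * cexp (-(s + 1) * u)) (Set.Ioi 0) ∧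
    ∫ u in Set.Ioi (0:ℝ), (psiOne (Real.exp u) : ℂ) * cexp (-(s + 1) * u) =
      (-deriv riemannZeta s / riemannZeta s) / (s * (s + 1)) := by
  obtain ⟨h1, h2⟩ := integral_psiOne hs
  have hd : ∀ x ∈ Set.Ioi (0:ℝ), HasDerivWithinAt Real.exp (Real.exp x) (Set.Ioi 0) x :=
    fun x _ ↦ (Real.hasDerivAt_exp x).hasDerivWithinAt
  have hE : ∀ u : ℝ, |Real.exp u| • ((psiOne (Real.exp u) : ℂ) * (Real.exp u : ℂ) ^ (-(s + 2)))
      = (psiOne (Real.exp u) : ℂ) * cexp (-(s + 1) * u) := fun u ↦ by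
    rw [ofReal_exp_cpow, Real.abs_exp, real_smul, ofReal_exp, mul_left_comm, ← Complex.exp_add]
    congr 2; ring
  rw [← image_exp_Ioi_zero, integrableOn_image_iff_integrableOn_abs_deriv_smul measurableSet_Ioi hd
    Real.exp_injective.injOn] at h1
  rw [← image_exp_Ioi_zero, integral_image_eq_integral_abs_deriv_smul measurableSet_Ioi hd
    Real.exp_injective.injOn] at h2
  simp only [hE] at h1 h2
  exact ⟨h1, h2⟩

lemma integral_exp_sub_one_sq {s : ℂ} (hs : 1 < s.re) :
    IntegrableOn (fun u : ℝ ↦ (((Real.exp u - 1) ^ 2 / 2 : ℝ) : ℂ) * cexp (-(s + 1) * u))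
      (Set.Ioi 0) ∧
    ∫ u in Set.Ioi (0:ℝ), (((Real.exp u - 1) ^ 2 / 2 : ℝ) : ℂ) * cexp (-(s + 1) * u) =
      1 / ((s - 1) * s * (s + 1)) := by
  have hE : ∀ u : ℝ, (((Real.exp u - 1) ^ 2 / 2 : ℝ) : ℂ) * cexp (-(s + 1) * u) =
      1 / 2 * cexp (-(s - 1) * u) - cexp (-s * u) + 1 / 2 * cexp (-(s + 1) * u) := fun u ↦ by
    have h1 : cexp (-s * u) = cexp u * cexp (-(s + 1) * u) := by
      rw [← Complex.exp_add]; congr 1; ring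
    have h2 : cexp (-(s - 1) * u) = cexp u * (cexp u * cexp (-(s + 1) * u)) := by
      rw [← Complex.exp_add, ← Complex.exp_add]; congr 1; ring
    rw [h1, h2]; push_cast; ring
  have r1 : (-(s - 1)).re < 0 := by simp; linarith
  have r2 : (-s).re < 0 := by simp; linarith
  have r3 : (-(s + 1)).re < 0 := by simp; linarith
  have n1 : s - 1 ≠ 0 := fun h ↦ by rw [h] at r1; simp at r1
  have n2 : s ≠ 0 := fun h ↦ by rw [h] at r2; simp at r2
  have n3 : s + 1 ≠ 0 := fun h ↦ by rw [h] at r3; simp at r3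
  have i1 := (integrableOn_exp_mul_complex_Ioi r1 0).const_mul (1 / 2)
  have i2 := integrableOn_exp_mul_complex_Ioi r2 0
  have i3 := (integrableOn_exp_mul_complex_Ioi r3 0).const_mul (1 / 2)
  simp only [hE]
  refine ⟨(i1.sub i2).add i3, ?_⟩
  have i12 : IntegrableOn (fun u : ℝ ↦ 1 / 2 * cexp (-(s - 1) * u) - cexp (-s * u))
    (Set.Ioi 0) := i1.sub i2
  rw [integral_add i12 i3, integral_sub i1 i2, integral_const_mul, integral_const_mul,
    integral_exp_mul_complex_Ioi r1, integral_exp_mul_complex_Ioi r2,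
    integral_exp_mul_complex_Ioi r3]
  simp only [ofReal_zero, mul_zero, Complex.exp_zero]
  field_simp
  ring

lemma integral_psiOneError {s : ℂ} (hs : 1 < s.re) :
    ∫ u in Set.Ioi (0:ℝ), (psiOneError u : ℂ) * cexp (-(s - 1) * u) = smoothedLogDeriv s := by
  obtain ⟨i1, e1⟩ := integral_psiOne_exp hs
  obtain ⟨i2, e2⟩ := integral_exp_sub_one_sq hs
  have hE : ∀ u : ℝ, (psiOneError u : ℂ) * cexp (-(s - 1) * u) =
      (psiOne (Real.exp u) : ℂ) * cexp (-(s + 1) * u) -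
        (((Real.exp u - 1) ^ 2 / 2 : ℝ) : ℂ) * cexp (-(s + 1) * u) := fun u ↦ by
    have : cexp (-(s + 1) * u) = cexp (-2 * u) * cexp (-(s - 1) * u) := by
      rw [← Complex.exp_add]; congr 1; ring
    rw [this, psiOneError]; push_cast; ring
  have hs1 : s ≠ 1 := by rintro rfl; simp at hs
  have hs0 : s ≠ 0 := by rintro rfl; simp at hs; linarith
  have n3 : s + 1 ≠ 0 := fun h ↦ by
    have : s.re + 1 = 0 := by simpa using congrArg Complex.re h
    linarith
  have hz := riemannZeta_ne_zero_of_one_le_re hs.le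
  simp only [hE]
  rw [integral_sub i1 i2, e1, e2, smoothedLogDeriv, deriv_riemannZeta₁_div hs1 hz]
  have := sub_ne_zero.mpr hs1
  field_simp
  ring

end PrimeSums

namespace PrimeSums

open Complex Topology MeasureTheory
open scoped FourierTransform Real

/-- `psiOneError`, extended by `0` to the left and damped by `exp (-ε u)`. -/
noncomputable def dampedError (ε u : ℝ) : ℂ := cexp (-ε * u) * psiOneError (max u 0)

lemma continuous_dampedError (ε : ℝ) : Continuous (dampedError ε) := by
  have := continuous_psiOneError
  unfold dampedError
  fun_prop

lemma dampedError_of_nonpos (ε : ℝ) {u : ℝ} (hu : u ≤ 0) : dampedError ε u = 0 := by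
  rw [dampedError, max_eq_right hu, psiOneError_zero, ofReal_zero, mul_zero]

lemma norm_dampedError (ε : ℝ) {u : ℝ} (hu : 0 ≤ u) :
    ‖dampedError ε u‖ = Real.exp (-ε * u) * |psiOneError u| := by
  rw [dampedError, max_eq_left hu, norm_mul, Complex.norm_exp, norm_real, Real.norm_eq_abs]
  simp

lemma integrable_pow_smul_dampedError {ε : ℝ} (hε : 0 < ε) (n : ℕ) :
    Integrable fun u : ℝ ↦ u ^ n • dampedError ε u := by
  have hg : IntegrableOn (fun u : ℝ ↦ (Real.log 4 + 5) * (u ^ (n : ℝ) * Real.exp (-ε * u ^ (1:ℝ))))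
      (Set.Ioi 0) :=
    (integrableOn_rpow_mul_exp_neg_mul_rpow (by linarith [(Nat.cast_nonneg n : (0:ℝ) ≤ n)])
      one_pos hε).const_mul _
  have hc : Continuous fun u : ℝ ↦ u ^ n • dampedError ε u := by
    have := continuous_dampedError ε
    fun_prop
  have h1 : IntegrableOn (fun u : ℝ ↦ u ^ n • dampedError ε u) (Set.Ioi 0) := by
    refine hg.mono' hc.aestronglyMeasurable ?_
    refine (ae_restrict_iff' measurableSet_Ioi).mpr (Eventually.of_forall fun u hu ↦ ?_)
    have hu : (0:ℝ) < u := hu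
    rw [norm_smul, norm_dampedError ε hu.le, norm_pow, Real.norm_of_nonneg hu.le, Real.rpow_natCast,
      Real.rpow_one]
    calc _ ≤ u ^ n * (Real.exp (-ε * u) * (Real.log 4 + 5)) := by
          gcongr; exact abs_psiOneError_le hu.le
      _ = _ := by ring
  refine (integrableOn_iff_integrable_of_support_subset fun u hu ↦ ?_).mp h1
  by_contra h
  exact hu (by simp [dampedError_of_nonpos ε (not_lt.mp h)])

lemma fourier_dampedError {ε : ℝ} (hε : 0 < ε) (w : ℝ) :
    𝓕 (dampedError ε) w = smoothedLogDeriv ((1 + ε : ℝ) + (2 * π : ℝ) * w * I) := by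
  rw [Real.fourier_real_eq_integral_exp_smul, ← integral_psiOneError (by simp [hε]),
    ← setIntegral_eq_integral_of_forall_compl_eq_zero (s := Set.Ioi 0)]
  · refine setIntegral_congr_fun measurableSet_Ioi fun u hu ↦ ?_
    have hu : (0:ℝ) < u := hu
    simp only [smul_eq_mul, dampedError, max_eq_left hu.le]
    rw [← mul_assoc, ← Complex.exp_add, mul_comm]
    congr 2
    push_cast; ring
  · intro u hu
    rw [dampedError_of_nonpos ε (not_lt.mp hu), smul_zero]

lemma exists_abs_psiOneError_le :
    ∃ C : ℝ, 0 < C ∧ ∀ u : ℝ, 0 < u → u ^ 4 * |psiOneError u| ≤ C := by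
  obtain ⟨K, hK, hKb⟩ := exists_norm_iteratedDeriv_le
  have hInt : Integrable (fun t : ℝ ↦ (1 + ‖t‖) ^ (-(39 / 32 : ℝ))) :=
    integrable_one_add_norm (by simp; norm_num)
  set J := ∫ t : ℝ, (1 + ‖t‖) ^ (-(39 / 32 : ℝ))
  have hJ : 0 ≤ J := integral_nonneg fun t ↦ by positivity
  refine ⟨K * J + 1, by positivity, fun u hu ↦ ?_⟩
  have key : ∀ ε ∈ Set.Ioc (0:ℝ) (1 / 2), u ^ 4 * (Real.exp (-ε * u) * |psiOneError u|) ≤ K * J := by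
    rintro ε ⟨hε, hε2⟩
    have hI : ∀ n : ℕ, (n : ℕ∞) ≤ 4 → Integrable fun u : ℝ ↦ u ^ n • dampedError ε u :=
      fun n _ ↦ integrable_pow_smul_dampedError hε n
    have h1 := Real.iteratedDeriv_fourier hI le_rfl
    set g : ℝ → ℂ := fun x : ℝ ↦ (-2 * π * I * x) ^ 4 • dampedError ε x with hg
    have hgi : Integrable g := by
      have := (integrable_pow_smul_dampedError hε 4).const_mul ((-2 * π * I) ^ 4)
      refine this.congr (Eventually.of_forall fun x ↦ ?_)
      simp only [hg, smul_eq_mul, real_smul]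
      push_cast; ring
    have hgc : Continuous g := by
      have := continuous_dampedError ε
      simp only [hg]
      fun_prop
    have h2 : ∀ t : ℝ, 𝓕 g t = (((2 * π : ℝ) : ℂ) * I) ^ 4 *
        iteratedDeriv 4 smoothedLogDeriv ((1 + ε : ℝ) + (2 * π : ℝ) * t * I) := fun t ↦ by
      rw [← iteratedDeriv_vertical (fun s hs ↦ analyticAt_smoothedLogDeriv (by rw [hs]; linarith)),
        ← funext (fourier_dampedError hε)]
      exact (congrFun h1 t).symm
    have h3 : ∀ t : ℝ, ‖𝓕 g t‖ ≤ (2 * π) ^ 4 * K * (1 + ‖t‖) ^ (-(39 / 32 : ℝ)) := fun t ↦ by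
      rw [h2, norm_mul, norm_pow, norm_mul, norm_I, mul_one, norm_real,
        Real.norm_of_nonneg (by positivity), mul_assoc (_ ^ 4)]
      gcongr
      have hre : (((1 + ε : ℝ) : ℂ) + (2 * π : ℝ) * t * I).re = 1 + ε := by simp
      have him : (((1 + ε : ℝ) : ℂ) + (2 * π : ℝ) * t * I).im = 2 * π * t := by simp
      refine (hKb _ (by rw [hre]; linarith) (by rw [hre]; linarith)).trans ?_
      rw [him, neg_div]
      gcongr ?_ * ?_
      refine Real.rpow_le_rpow_of_nonpos (by positivity) ?_ (by norm_num)
      rw [abs_mul, abs_of_pos (by positivity : 0 < 2 * π), Real.norm_eq_abs]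
      nlinarith [Real.pi_gt_three, abs_nonneg t]
    have hFc : Continuous (𝓕 g) :=
      VectorFourier.fourierIntegral_continuous Real.continuous_fourierChar
        (by fun_prop) hgi
    have hFi : Integrable (𝓕 g) :=
      (hInt.const_mul ((2 * π) ^ 4 * K)).mono' hFc.aestronglyMeasurable (Eventually.of_forall h3)
    have h4 := congrFun (hgc.fourierInv_fourier_eq hgi hFi) u
    have h5 : ‖g u‖ ≤ (2 * π) ^ 4 * K * J := by
      rw [← h4, Real.fourierInv_eq', ← integral_const_mul]
      refine (norm_integral_le_integral_norm _).trans (integral_mono_of_nonneg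
        (Eventually.of_forall fun t ↦ norm_nonneg _) (hInt.const_mul _)
        (Eventually.of_forall fun t ↦ ?_))
      simp only [norm_smul]
      rw [Complex.norm_exp_ofReal_mul_I, one_mul]
      exact h3 t
    have h6 : ‖g u‖ = (2 * π) ^ 4 * (u ^ 4 * (Real.exp (-ε * u) * |psiOneError u|)) := by
      rw [hg, norm_smul, norm_dampedError ε hu.le, norm_pow]
      simp only [norm_mul, norm_neg, norm_I, norm_real, Complex.norm_ofNat, Real.norm_of_nonneg hu.le,
        Real.norm_of_nonneg Real.pi_pos.le]
      ring
    rw [h6, mul_assoc] at h5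
    exact le_of_mul_le_mul_left h5 (by positivity)
  have hlim : Tendsto (fun ε : ℝ ↦ u ^ 4 * (Real.exp (-ε * u) * |psiOneError u|)) (𝓝[>] 0)
      (𝓝 (u ^ 4 * (Real.exp (-0 * u) * |psiOneError u|))) := by
    refine (Continuous.tendsto ?_ 0).mono_left nhdsWithin_le_nhds
    fun_prop
  have := le_of_tendsto hlim (Filter.eventually_of_mem (Ioc_mem_nhdsGT (by norm_num)) key)
  simp only [neg_zero, zero_mul, Real.exp_zero, one_mul] at this
  linarith

end PrimeSums

namespace PrimeSums

lemma exists_abs_psiOne_sub_le :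
    ∃ C : ℝ, 0 < C ∧ ∀ x : ℝ, 1 < x →
      |psiOne x - (x - 1) ^ 2 / 2| ≤ C * (x ^ 2 / Real.log x ^ 4) := by
  obtain ⟨C, hC, h⟩ := exists_abs_psiOneError_le
  refine ⟨C, hC, fun x hx ↦ ?_⟩
  have hx0 : 0 < x := by linarith
  have hl := Real.log_pos hx
  have := h _ hl
  have h2 : Real.exp (-2 * Real.log x) = (x ^ 2)⁻¹ := by
    rw [show -2 * Real.log x = -(Real.log x + Real.log x) by ring, Real.exp_neg, Real.exp_add,
      Real.exp_log hx0, sq]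
  rw [psiOneError, Real.exp_log hx0, h2, abs_mul, abs_of_pos (by positivity : 0 < (x ^ 2)⁻¹)] at this
  rw [← mul_div_assoc, le_div_iff₀ (by positivity)]
  have h3 := mul_le_mul_of_nonneg_right this (sq_nonneg x)
  calc _ = Real.log x ^ 4 * ((x ^ 2)⁻¹ * |psiOne x - (x - 1) ^ 2 / 2|) * x ^ 2 := by
        field_simp
    _ ≤ _ := h3

lemma log_sq_le_four_mul {x : ℝ} (hx : 1 ≤ x) : Real.log x ^ 2 ≤ 4 * x := by
  have h := Real.log_le_rpow_div (by linarith : 0 ≤ x) (by norm_num : (0:ℝ) < 1 / 2)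
  have h0 := Real.log_nonneg hx
  rw [← Real.sqrt_eq_rpow] at h
  have := pow_le_pow_left₀ h0 h 2
  rw [div_pow, Real.sq_sqrt (by linarith)] at this
  norm_num at this
  linarith

lemma psi_upper {C x : ℝ} (hC : ∀ x : ℝ, 1 < x →
    |psiOne x - (x - 1) ^ 2 / 2| ≤ C * (x ^ 2 / Real.log x ^ 4)) (hC0 : 0 < C)
    (hx : 2 ≤ Real.log x) (hx0 : 1 < x) :
    Chebyshev.psi x ≤ x + (1 / 2 + 5 * C) * (x / Real.log x ^ 2) := by
  set l := Real.log x with hl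
  set h := 1 / l ^ 2 with hh
  have hh0 : 0 < h := by positivity
  have hh1 : h ≤ 1 := by
    rw [hh, div_le_one (by positivity)]; nlinarith
  have hxy : x ≤ x * (1 + h) := by nlinarith
  have h1 := mul_psi_le_psiOne_sub (by linarith) hxy
  have h2 := abs_le.mp (hC x hx0)
  have h3 := abs_le.mp (hC (x * (1 + h)) (by linarith))
  have h4 : (x * (1 + h)) ^ 2 / Real.log (x * (1 + h)) ^ 4 ≤ 4 * (x ^ 2 / l ^ 4) := by
    rw [← mul_div_assoc]
    have : l ≤ Real.log (x * (1 + h)) := Real.log_le_log (by linarith) hxy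
    gcongr
    nlinarith [mul_le_mul_of_nonneg_left hh1 (by linarith : 0 ≤ x), mul_pos (by linarith : 0 < x) hh0]
  have h5 : x * h * Chebyshev.psi x ≤ x * h * (x + (1 / 2 + 5 * C) * (x * h)) := by
    have e1 : x ^ 2 / l ^ 4 = (x * h) ^ 2 := by rw [hh]; field_simp
    rw [e1] at h2 h4
    have := mul_le_mul_of_nonneg_left h4 hC0.le
    nlinarith [mul_pos (by linarith : 0 < x) hh0]
  have h6 := le_of_mul_le_mul_left h5 (by positivity)
  rwa [hh, mul_one_div] at h6

lemma psi_lower {C x : ℝ} (hC : ∀ x : ℝ, 1 < x →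
    |psiOne x - (x - 1) ^ 2 / 2| ≤ C * (x ^ 2 / Real.log x ^ 4)) (hC0 : 0 < C)
    (hx : 2 ≤ Real.log x) (hx0 : 1 < x) :
    x - (5 + 17 * C) * (x / Real.log x ^ 2) ≤ Chebyshev.psi x := by
  have hlx : Real.log x ≤ x - 1 := Real.log_le_sub_one_of_pos (by linarith)
  have hlog2 := log_sq_le_four_mul hx0.le
  set l := Real.log x with hl
  set h := 1 / l ^ 2 with hh
  have hh0 : 0 < h := by positivity
  have hh1 : h ≤ 1 / 4 := by
    rw [hh, div_le_div_iff₀ (by positivity) (by norm_num)]; nlinarith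
  have hxh : 1 ≤ 4 * (x * h) := by
    rw [hh, mul_one_div, ← mul_div_assoc, le_div_iff₀ (by positivity)]; linarith
  have hx2 : Real.exp 2 ≤ x := by rwa [← Real.le_log_iff_exp_le (by linarith)]
  have hx4 : 4 ≤ x := by
    have := Real.add_one_lt_exp (by norm_num : (1:ℝ) ≠ 0)
    have e : Real.exp 2 = Real.exp 1 * Real.exp 1 := by rw [← Real.exp_add]; norm_num
    nlinarith
  have hyx : x * (1 - h) ≤ x := by nlinarith
  have hy : x / 2 ≤ x * (1 - h) := by nlinarith
  have hly : l / 2 ≤ Real.log (x * (1 - h)) := by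
    have h1 : Real.log (x / 2) ≤ Real.log (x * (1 - h)) := Real.log_le_log (by linarith) hy
    rw [Real.log_div (by linarith) (by norm_num)] at h1
    have : Real.log 2 ≤ l / 2 := by
      have : Real.log 2 ≤ 2 - 1 := Real.log_le_sub_one_of_pos (by norm_num)
      linarith
    linarith
  have h1 := psiOne_sub_le_mul_psi (by linarith) hyx
  have h2 := abs_le.mp (hC x hx0)
  have h3 := abs_le.mp (hC (x * (1 - h)) (by linarith))
  have h4 : (x * (1 - h)) ^ 2 / Real.log (x * (1 - h)) ^ 4 ≤ 16 * (x ^ 2 / l ^ 4) := by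
    calc _ ≤ x ^ 2 / (l / 2) ^ 4 := by gcongr; linarith
      _ = _ := by field_simp; norm_num
  have h5 : x * h * (x - (5 + 17 * C) * (x * h)) ≤ x * h * Chebyshev.psi x := by
    have e1 : x ^ 2 / l ^ 4 = (x * h) ^ 2 := by rw [hh]; field_simp
    rw [e1] at h2 h4
    have := mul_le_mul_of_nonneg_left h4 hC0.le
    nlinarith [mul_pos (by linarith : 0 < x) hh0]
  have h6 := le_of_mul_le_mul_left h5 (by positivity)
  rwa [hh, mul_one_div] at h6

lemma exists_abs_psi_sub_le :
    ∃ C : ℝ, 0 < C ∧ ∀ x : ℝ, 2 ≤ x → |Chebyshev.psi x - x| ≤ C * (x / Real.log x ^ 2) := by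
  obtain ⟨C, hC, h⟩ := exists_abs_psiOne_sub_le
  have hl4 : 0 ≤ Real.log 4 := Real.log_nonneg (by norm_num)
  refine ⟨5 + 17 * C + 4 * (Real.log 4 + 5), by positivity, fun x hx ↦ ?_⟩
  have hlx := Real.log_pos (by linarith : 1 < x)
  have hpos : 0 < x / Real.log x ^ 2 := by positivity
  rcases le_or_gt 2 (Real.log x) with hl | hl
  · have h1 := psi_upper h hC hl (by linarith)
    have h2 := psi_lower h hC hl (by linarith)
    rw [abs_le]
    constructor <;> nlinarith [mul_pos hC hpos, mul_nonneg hl4 hpos.le]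
  · have h1 := Chebyshev.psi_le_const_mul_self (by linarith : 0 ≤ x)
    have h2 := Chebyshev.psi_nonneg x
    have h3 : x ≤ 4 * (x / Real.log x ^ 2) := by
      rw [← mul_div_assoc, le_div_iff₀ (by positivity)]
      have : Real.log x ^ 2 ≤ 4 := by nlinarith
      nlinarith
    have h4 : |Chebyshev.psi x - x| ≤ (Real.log 4 + 5) * x := by
      rw [abs_le]
      constructor <;> nlinarith [mul_nonneg hl4 (by linarith : 0 ≤ x)]
    nlinarith [mul_pos hC hpos, mul_le_mul_of_nonneg_left h3 (by linarith : 0 ≤ Real.log 4 + 5)]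

lemma sqrt_mul_log_le {x : ℝ} (hx : 2 ≤ x) :
    √x * Real.log x ≤ 216 * (x / Real.log x ^ 2) := by
  have h := Real.log_le_rpow_div (by linarith : 0 ≤ x) (by norm_num : (0:ℝ) < 1 / 6)
  have h0 := Real.log_pos (by linarith : 1 < x)
  have h3 := pow_le_pow_left₀ h0.le h 3
  rw [div_pow, ← Real.rpow_natCast (x ^ _), ← Real.rpow_mul (by linarith),
    show (1 / 6 : ℝ) * (3 : ℕ) = 1 / 2 by norm_num, ← Real.sqrt_eq_rpow] at h3
  rw [← mul_div_assoc, le_div_iff₀ (by positivity)]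
  have h4 : √x * √x = x := Real.mul_self_sqrt (by linarith)
  have h5 := mul_le_mul_of_nonneg_left h3 (Real.sqrt_nonneg x)
  calc _ = √x * Real.log x ^ 3 := by ring
    _ ≤ √x * (√x / (1 / 6) ^ 3) := h5
    _ = 216 * (√x * √x) := by ring
    _ = _ := by rw [h4]

/-- The prime number theorem with error term `O(x / log² x)`. -/
lemma exists_abs_theta_sub_le :
    ∃ C : ℝ, 0 < C ∧ ∀ x : ℝ, 2 ≤ x → |Chebyshev.theta x - x| ≤ C * (x / Real.log x ^ 2) := by
  obtain ⟨C, hC, h⟩ := exists_abs_psi_sub_le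
  refine ⟨C + 432, by positivity, fun x hx ↦ ?_⟩
  have h1 := h x hx
  have h2 := Chebyshev.abs_psi_sub_theta_le_sqrt_mul_log (by linarith : 1 ≤ x)
  have h3 := sqrt_mul_log_le hx
  rw [abs_le] at *
  constructor <;> nlinarith

end PrimeSums

namespace PrimeSums

open MeasureTheory

/-- The function `t ^ a / log ^ j t`. -/
noncomputable def powLog (a : ℝ) (j : ℕ) (t : ℝ) : ℝ := t ^ a / Real.log t ^ j

lemma powLog_pos (a : ℝ) (j : ℕ) {t : ℝ} (ht : 1 < t) : 0 < powLog a j t := by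
  have := Real.log_pos ht
  have : 0 < t := by linarith
  unfold powLog
  positivity

lemma rpow_mul_powLog (a b : ℝ) (j : ℕ) {t : ℝ} (ht : 1 < t) :
    t ^ b * powLog a j t = powLog (b + a) j t := by
  rw [powLog, powLog, Real.rpow_add (by linarith), mul_div_assoc]

lemma mul_powLog (a : ℝ) (j : ℕ) {t : ℝ} (ht : 1 < t) : t * powLog a j t = powLog (a + 1) j t := by
  have := rpow_mul_powLog a 1 j ht
  rwa [Real.rpow_one, add_comm] at this

lemma powLog_div_log_pow (a : ℝ) (j k : ℕ) (t : ℝ) :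
    powLog a j t / Real.log t ^ k = powLog a (j + k) t := by
  rw [powLog, powLog, div_div, pow_add]

lemma powLog_succ_mul_log (a : ℝ) (j : ℕ) {t : ℝ} (ht : 1 < t) :
    powLog a (j + 1) t * Real.log t = powLog a j t := by
  have := (Real.log_pos ht).ne'
  rw [powLog, powLog]
  field_simp
  ring

lemma powLog_succ_le (a : ℝ) (j : ℕ) {t : ℝ} (ht : 2 ≤ t) :
    powLog a (j + 1) t ≤ 2 * powLog a j t := by
  have h := powLog_succ_mul_log a j (by linarith : 1 < t)
  have h2 := Real.log_two_gt_d9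
  have h3 : Real.log 2 ≤ Real.log t := Real.log_le_log (by norm_num) ht
  have h4 := powLog_pos a (j + 1) (by linarith : 1 < t)
  rw [← h]
  nlinarith

lemma hasDerivAt_powLog (a : ℝ) (j : ℕ) {t : ℝ} (ht : 1 < t) :
    HasDerivAt (powLog a j) (a * powLog (a - 1) j t - j * powLog (a - 1) (j + 1) t) t := by
  have ht0 : t ≠ 0 := by linarith
  have hl := (Real.log_pos ht).ne'
  have h1 := Real.hasDerivAt_rpow_const (p := a) (Or.inl ht0)
  have h2 := (Real.hasDerivAt_log ht0).pow j
  refine (h1.div h2 (pow_ne_zero j hl)).congr_deriv ?_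
  have e : t ^ a = t * t ^ (a - 1) := by
    rw [Real.rpow_sub_one ht0]; field_simp
  simp only [powLog, Pi.pow_apply]
  rw [e]
  rcases j with _ | j
  · simp
  · simp only [Nat.add_sub_cancel]
    field_simp
    ring

lemma continuousOn_powLog (a : ℝ) (j : ℕ) : ContinuousOn (powLog a j) (Set.Ioi 1) :=
  fun _ ht ↦ (hasDerivAt_powLog a j ht).continuousAt.continuousWithinAt

lemma intervalIntegrable_powLog (a : ℝ) (j : ℕ) {y : ℝ} (hy : 2 ≤ y) :
    IntervalIntegrable (powLog a j) volume 2 y := by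
  refine ((continuousOn_powLog a j).mono fun t ht ↦ ?_).intervalIntegrable
  rw [Set.uIcc_of_le hy] at ht
  exact lt_of_lt_of_le (by norm_num) ht.1

lemma exists_powLog_half_le (k : ℕ) :
    ∃ C : ℝ, 0 < C ∧ ∀ t y : ℝ, 2 ≤ t → t ≤ y → powLog (1 / 2) k t ≤ C * powLog (1 / 2) k y := by
  set ε : ℝ := 1 / (2 * (k + 1)) with hε
  have hε0 : 0 < ε := by positivity
  refine ⟨(1 + 2 / ε) ^ k, by positivity, fun t y ht hty ↦ ?_⟩
  have ht0 : 0 < t := by linarith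
  have hy0 : 0 < y := by linarith
  have hlt := Real.log_pos (by linarith : 1 < t)
  have hly := Real.log_pos (by linarith : 1 < y)
  have hu : 1 ≤ y / t := by rwa [one_le_div ht0]
  have h1 : Real.log y = Real.log t + Real.log (y / t) := by
    rw [Real.log_div hy0.ne' ht0.ne']; ring
  have h2 := Real.log_le_rpow_div (by linarith : 0 ≤ y / t) hε0
  have h3 : 1 ≤ (y / t) ^ ε := Real.one_le_rpow hu hε0.le
  have hlt2 : 1 ≤ 2 * Real.log t := by
    have := Real.log_two_gt_d9
    have h3 : Real.log 2 ≤ Real.log t := Real.log_le_log (by norm_num) ht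
    linarith
  have h4 : Real.log y ≤ Real.log t * ((1 + 2 / ε) * (y / t) ^ ε) := by
    have e : (y / t) ^ ε / ε ≤ (y / t) ^ ε / ε * (2 * Real.log t) :=
      le_mul_of_one_le_right (by positivity) hlt2
    have e2 : Real.log t ≤ Real.log t * (y / t) ^ ε := le_mul_of_one_le_right hlt.le h3
    calc _ ≤ Real.log t * (y / t) ^ ε + (y / t) ^ ε / ε * (2 * Real.log t) := by linarith
      _ = _ := by ring
  have h5 := pow_le_pow_left₀ hly.le h4 k
  have h6 : ((y / t) ^ ε) ^ k ≤ y ^ (1 / 2 : ℝ) / t ^ (1 / 2 : ℝ) := by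
    rw [← Real.rpow_natCast, ← Real.rpow_mul (by positivity), ← Real.div_rpow hy0.le ht0.le]
    refine Real.rpow_le_rpow_of_exponent_le hu ?_
    rw [hε, div_mul_eq_mul_div, div_le_div_iff₀ (by positivity) (by norm_num)]
    linarith
  rw [powLog, powLog, ← mul_div_assoc, div_le_div_iff₀ (by positivity) (by positivity)]
  have h7 : 0 < t ^ (1 / 2 : ℝ) := by positivity
  rw [mul_pow, mul_pow] at h5
  calc _ ≤ t ^ (1 / 2 : ℝ) * (Real.log t ^ k * ((1 + 2 / ε) ^ k * (y ^ (1 / 2 : ℝ) / t ^ (1 / 2 : ℝ)))) := by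
        gcongr
        exact h5.trans (by gcongr)
    _ = _ := by field_simp

lemma exists_integral_powLog_le {β : ℝ} (hβ : 0 < β) (k : ℕ) :
    ∃ C : ℝ, 0 < C ∧ ∀ y : ℝ, 2 ≤ y → ∫ t in (2:ℝ)..y, powLog β k t ≤ C * powLog (β + 1) k y := by
  obtain ⟨C, hC, h⟩ := exists_powLog_half_le k
  refine ⟨C / (β + 1 / 2), by positivity, fun y hy ↦ ?_⟩
  have hi : IntervalIntegrable (fun t : ℝ ↦ C * powLog (1 / 2) k y * t ^ (β - 1 / 2)) volume 2 y :=
    (intervalIntegral.intervalIntegrable_rpow' (by linarith)).const_mul _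
  calc _ ≤ ∫ t in (2:ℝ)..y, C * powLog (1 / 2) k y * t ^ (β - 1 / 2) := by
        refine intervalIntegral.integral_mono_on hy (intervalIntegrable_powLog β k hy) hi
          fun t ht ↦ ?_
        have e := rpow_mul_powLog (1 / 2) (β - 1 / 2) k (by linarith [ht.1] : 1 < t)
        rw [sub_add_cancel] at e
        rw [← e, mul_comm]
        have : 0 < t := by linarith [ht.1]
        gcongr
        exact h t y ht.1 ht.2
    _ = C * powLog (1 / 2) k y *
        ((y ^ (β + 1 / 2) - 2 ^ (β + 1 / 2)) / (β + 1 / 2)) := by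
      rw [intervalIntegral.integral_const_mul, integral_rpow (Or.inl (by linarith)),
        show β - 1 / 2 + 1 = β + 1 / 2 by ring]
    _ ≤ C * powLog (1 / 2) k y * (y ^ (β + 1 / 2) / (β + 1 / 2)) := by
      have := powLog_pos (1 / 2) k (by linarith : 1 < y)
      gcongr
      have : (0:ℝ) < 2 ^ (β + 1 / 2) := by positivity
      linarith
    _ = C / (β + 1 / 2) * (y ^ (β + 1 / 2) * powLog (1 / 2) k y) := by ring
    _ = _ := by
      rw [rpow_mul_powLog _ _ _ (by linarith : 1 < y)]; congr 2; ring

lemma exists_one_le_powLog {a : ℝ} (ha : 1 / 2 ≤ a) (k : ℕ) :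
    ∃ C : ℝ, 0 < C ∧ ∀ y : ℝ, 2 ≤ y → 1 ≤ C * powLog a k y := by
  obtain ⟨C, hC, h⟩ := exists_powLog_half_le k
  have h2 := powLog_pos (1 / 2) k (by norm_num : (1:ℝ) < 2)
  refine ⟨C / powLog (1 / 2) k 2, by positivity, fun y hy ↦ ?_⟩
  have h3 := h 2 y le_rfl hy
  have h4 : powLog (1 / 2) k y ≤ powLog a k y := by
    have := Real.log_pos (by linarith : 1 < y)
    unfold powLog
    gcongr
    linarith
  rw [div_mul_eq_mul_div, one_le_div h2]
  exact h3.trans (by gcongr)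

end PrimeSums

namespace PrimeSums

open MeasureTheory

lemma sum_powLog_primes_eq (a : ℝ) (j : ℕ) {y : ℝ} (hy : 2 ≤ y) :
    ∑ p ∈ (Icc 2 ⌊y⌋₊).filter Nat.Prime, powLog a j p =
      powLog a (j + 1) y * Chebyshev.theta y -
        ∫ t in (2:ℝ)..y, deriv (powLog a (j + 1)) t * Chebyshev.theta t := by
  have hθ : ∀ t, Chebyshev.theta t =
      ∑ k ∈ Icc 0 ⌊t⌋₊, if k.Prime then Real.log (k : ℝ) else 0 := fun t ↦ by
    rw [Chebyshev.theta_eq_sum_Icc, sum_filter]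
  have hd : ∀ t ∈ Set.Icc 2 y, HasDerivAt (powLog a (j + 1)) _ t := fun t ht ↦
    hasDerivAt_powLog a (j + 1) (by linarith [ht.1])
  have hInt : IntegrableOn (deriv (powLog a (j + 1))) (Set.Icc 2 y) := by
    have h1 := ((intervalIntegrable_powLog (a - 1) (j + 1) hy).const_mul a).sub
      ((intervalIntegrable_powLog (a - 1) (j + 1 + 1) hy).const_mul ((j + 1 : ℕ) : ℝ))
    rw [intervalIntegrable_iff_integrableOn_Icc_of_le hy] at h1
    exact h1.congr_fun (fun t ht ↦ (hd t ht).deriv.symm) measurableSet_Icc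
  have h := sum_mul_eq_sub_integral_mul₁ (fun k : ℕ ↦ if k.Prime then Real.log (k : ℝ) else 0)
    (by simp) (by simp) y (fun t ht ↦ (hd t ht).differentiableAt) hInt
  simp only [← hθ] at h
  rw [intervalIntegral.integral_of_le hy, ← h]
  simp only [mul_ite, mul_zero]
  rw [← sum_filter]
  have hs : (Icc 0 ⌊y⌋₊).filter Nat.Prime = (Icc 2 ⌊y⌋₊).filter Nat.Prime := by
    ext p
    simp only [mem_filter, mem_Icc]
    exact ⟨fun h ↦ ⟨⟨h.2.two_le, h.1.2⟩, h.2⟩, fun h ↦ ⟨⟨Nat.zero_le _, h.1.2⟩, h.2⟩⟩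
  rw [hs]
  refine sum_congr rfl fun p hp ↦ ?_
  rw [powLog_succ_mul_log]
  exact_mod_cast (mem_filter.mp hp).2.one_lt

lemma exists_abs_sum_powLog_primes_sub_le {β : ℝ} (hβ : 0 < β) (j : ℕ) :
    ∃ C : ℝ, 0 < C ∧ ∀ y : ℝ, 2 ≤ y →
      |∑ p ∈ (Icc 2 ⌊y⌋₊).filter Nat.Prime, powLog β j p -
        (powLog (β + 1) (j + 1) y / (β + 1) +
          (j + 1) * powLog (β + 1) (j + 2) y / (β + 1) ^ 2)| ≤ C * powLog (β + 1) (j + 3) y := by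
  obtain ⟨A, hA, hθ⟩ := exists_abs_theta_sub_le
  obtain ⟨B, hB, hI⟩ := exists_integral_powLog_le hβ (j + 3)
  obtain ⟨D, hD, h1⟩ := exists_one_le_powLog (by linarith : 1 / 2 ≤ β + 1) (j + 3)
  set c : ℝ := (j + 1) * (j + 2) / (β + 1) ^ 2 with hc
  set f := powLog β (j + 1) with hf
  set P : ℝ → ℝ := fun t ↦ powLog (β + 1) (j + 1) t -
    (powLog (β + 1) (j + 1) t / (β + 1) + (j + 1) * powLog (β + 1) (j + 2) t / (β + 1) ^ 2) with hP
  set f' : ℝ → ℝ := fun t ↦ β * powLog (β - 1) (j + 1) t - (j + 1) * powLog (β - 1) (j + 2) t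
    with hf'
  set P' : ℝ → ℝ := fun t ↦ t * f' t + c * powLog β (j + 3) t with hP'
  have hfd : ∀ t, 1 < t → HasDerivAt f (f' t) t := fun t ht ↦
    (hasDerivAt_powLog β (j + 1) ht).congr_deriv (by simp only [hf']; push_cast; rfl)
  have htf : ∀ t, 1 < t → t * f' t = β * powLog β (j + 1) t - (j + 1) * powLog β (j + 2) t := by
    intro t ht
    have e1 := mul_powLog (β - 1) (j + 1) ht
    have e2 := mul_powLog (β - 1) (j + 2) ht
    rw [sub_add_cancel] at e1 e2
    rw [← e1, ← e2]
    simp only [hf']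
    ring
  have hPd : ∀ t, 1 < t → HasDerivAt P (P' t) t := fun t ht ↦ by
    have d1 := hasDerivAt_powLog (β + 1) (j + 1) ht
    have d2 := hasDerivAt_powLog (β + 1) (j + 2) ht
    refine (d1.sub ((d1.div_const (β + 1)).add
      ((d2.const_mul ((j : ℝ) + 1)).div_const ((β + 1) ^ 2)))).congr_deriv ?_
    simp only [hP', htf t ht, hc, add_sub_cancel_right]
    push_cast
    field_simp
    ring
  have hB1 : 0 < β + 1 := by linarith
  have hc0 : 0 < c := by positivity
  set K : ℝ := (β + 2 * (j + 1)) * A + c with hK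
  have hK0 : 0 < K := by positivity
  refine ⟨A + |P 2| * D + K * B, by positivity, fun y hy ↦ ?_⟩
  have hicc : Set.uIcc 2 y = Set.Icc 2 y := Set.uIcc_of_le hy
  have hf'c : ContinuousOn f' (Set.uIcc 2 y) := by
    rw [hicc]
    have e : Set.Icc 2 y ⊆ Set.Ioi (1:ℝ) := fun t ht ↦ lt_of_lt_of_le (by norm_num) ht.1
    exact (((continuousOn_powLog _ _).mono e).const_mul _).sub
      (((continuousOn_powLog _ _).mono e).const_mul _)
  have hP'i : IntervalIntegrable P' volume 2 y :=
    ((continuousOn_id.mul hf'c).intervalIntegrable).add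
      ((intervalIntegrable_powLog β (j + 3) hy).const_mul c)
  have hθi : IntervalIntegrable (fun t ↦ f' t * Chebyshev.theta t) volume 2 y :=
    (Chebyshev.theta_mono.intervalIntegrable).continuousOn_mul hf'c
  have hFTC := intervalIntegral.integral_eq_sub_of_hasDerivAt (f := P) (f' := P') (a := 2) (b := y)
    (fun t ht ↦ hPd t (by rw [hicc] at ht; linarith [ht.1])) hP'i
  have hderiv : ∫ t in (2:ℝ)..y, deriv f t * Chebyshev.theta t =
      ∫ t in (2:ℝ)..y, f' t * Chebyshev.theta t := by
    refine intervalIntegral.integral_congr fun t ht ↦ ?_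
    rw [hicc] at ht
    simp only [(hfd t (by linarith [ht.1])).deriv]
  have hbound : |∫ t in (2:ℝ)..y, (P' t - f' t * Chebyshev.theta t)| ≤
      K * ∫ t in (2:ℝ)..y, powLog β (j + 3) t := by
    rw [← intervalIntegral.integral_const_mul, ← Real.norm_eq_abs]
    refine intervalIntegral.norm_integral_le_of_norm_le hy ?_
      ((intervalIntegrable_powLog β (j + 3) hy).const_mul K)
    refine Eventually.of_forall fun t ht ↦ ?_
    have ht1 : 1 < t := by linarith [ht.1]
    have ht2 : 2 ≤ t := ht.1.le
    have hE := hθ t ht2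
    have e1 : P' t - f' t * Chebyshev.theta t =
        -(f' t * (Chebyshev.theta t - t)) + c * powLog β (j + 3) t := by
      simp only [hP']; ring
    have e2 : |f' t| * (t / Real.log t ^ 2) ≤ (β + 2 * (j + 1)) * powLog β (j + 3) t := by
      have p1 := powLog_pos β (j + 1 + 2) ht1
      have p2 := powLog_pos β (j + 2 + 2) ht1
      have p3 := powLog_succ_le β (j + 3) ht2
      have : 0 < t / Real.log t ^ 2 := by
        have := Real.log_pos ht1
        have : 0 < t := by linarith
        positivity
      rw [← abs_of_pos this, ← abs_mul, mul_comm (f' t), div_mul_eq_mul_div, htf t ht1, sub_div,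
        mul_div_assoc, mul_div_assoc, powLog_div_log_pow, powLog_div_log_pow, abs_le]
      have j0 : (0:ℝ) ≤ j := Nat.cast_nonneg j
      have q1 : (0:ℝ) < β * powLog β (j + 1 + 2) t := by positivity
      have q2 : (0:ℝ) < (j + 1) * powLog β (j + 2 + 2) t := by positivity
      have q3 : (j + 1) * powLog β (j + 2 + 2) t ≤ (j + 1) * (2 * powLog β (j + 1 + 2) t) := by
        gcongr
      have q4 : (0:ℝ) < (j + 1) * powLog β (j + 1 + 2) t := by positivity
      have q5 : powLog β (j + 1 + 2) t = powLog β (j + 3) t := rfl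
      constructor <;> linarith
    rw [e1, Real.norm_eq_abs]
    refine (abs_add_le _ _).trans ?_
    rw [abs_neg, abs_mul, abs_of_pos (mul_pos hc0 (powLog_pos β (j + 3) ht1))]
    calc _ ≤ |f' t| * (A * (t / Real.log t ^ 2)) + c * powLog β (j + 3) t := by gcongr
      _ = A * (|f' t| * (t / Real.log t ^ 2)) + c * powLog β (j + 3) t := by ring
      _ ≤ A * ((β + 2 * (j + 1)) * powLog β (j + 3) t) + c * powLog β (j + 3) t := by gcongr
      _ = _ := by rw [hK]; ring
  have hy1 : 1 < y := by linarith
  have hfE : |f y * (Chebyshev.theta y - y)| ≤ A * powLog (β + 1) (j + 3) y := by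
    have p := powLog_pos β (j + 1) hy1
    rw [abs_mul, abs_of_pos p]
    calc _ ≤ powLog β (j + 1) y * (A * (y / Real.log y ^ 2)) := by gcongr; exact hθ y hy
      _ = A * (y * powLog β (j + 1) y / Real.log y ^ 2) := by ring
      _ = _ := by rw [mul_powLog β (j + 1) hy1, powLog_div_log_pow]
  have hmain : ∑ p ∈ (Icc 2 ⌊y⌋₊).filter Nat.Prime, powLog β j p -
        (powLog (β + 1) (j + 1) y / (β + 1) + (j + 1) * powLog (β + 1) (j + 2) y / (β + 1) ^ 2) =
      f y * (Chebyshev.theta y - y) + P 2 +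
        ∫ t in (2:ℝ)..y, (P' t - f' t * Chebyshev.theta t) := by
    rw [intervalIntegral.integral_sub hP'i hθi, hFTC, sum_powLog_primes_eq β j hy, ← hf, hderiv]
    have e := mul_powLog β (j + 1) hy1
    simp only [hP]
    rw [← e]
    ring
  rw [hmain]
  have hJ := hbound.trans (mul_le_mul_of_nonneg_left (hI y hy) hK0.le)
  have hP2 : |P 2| ≤ |P 2| * (D * powLog (β + 1) (j + 3) y) :=
    le_mul_of_one_le_right (abs_nonneg _) (h1 y hy)
  calc _ ≤ |f y * (Chebyshev.theta y - y)| + |P 2| +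
        |∫ t in (2:ℝ)..y, (P' t - f' t * Chebyshev.theta t)| := abs_add_three _ _ _
    _ ≤ A * powLog (β + 1) (j + 3) y + |P 2| * (D * powLog (β + 1) (j + 3) y) +
        K * (B * powLog (β + 1) (j + 3) y) := by gcongr
    _ = _ := by ring

end PrimeSums

namespace PrimeSums

lemma exists_abs_sum_powLog_primes_le {β : ℝ} (hβ : 0 < β) (j : ℕ) :
    ∃ C : ℝ, 0 < C ∧ ∀ y : ℝ, 2 ≤ y →
      ∑ p ∈ (Icc 2 ⌊y⌋₊).filter Nat.Prime, powLog β j p ≤ C * powLog (β + 1) (j + 1) y := by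
  obtain ⟨C, hC, h⟩ := exists_abs_sum_powLog_primes_sub_le hβ j
  refine ⟨1 / (β + 1) + 2 * ((j + 1) / (β + 1) ^ 2) + 4 * C, by positivity, fun y hy ↦ ?_⟩
  have h0 := (abs_le.mp (h y hy)).2
  have h1 := powLog_succ_le (β + 1) (j + 1) hy
  have h2 := powLog_succ_le (β + 1) (j + 2) hy
  have h3 : (j + 1) / (β + 1) ^ 2 * powLog (β + 1) (j + 2) y ≤
      (j + 1) / (β + 1) ^ 2 * (2 * powLog (β + 1) (j + 1) y) := by gcongr
  have h4 : C * powLog (β + 1) (j + 3) y ≤ C * (4 * powLog (β + 1) (j + 1) y) := by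
    gcongr; linarith
  calc _ ≤ powLog (β + 1) (j + 1) y / (β + 1) +
        (j + 1) / (β + 1) ^ 2 * powLog (β + 1) (j + 2) y + C * powLog (β + 1) (j + 3) y := by
        rw [div_mul_eq_mul_div]; linarith
    _ ≤ powLog (β + 1) (j + 1) y / (β + 1) +
        (j + 1) / (β + 1) ^ 2 * (2 * powLog (β + 1) (j + 1) y) +
        C * (4 * powLog (β + 1) (j + 1) y) := by gcongr
    _ = _ := by ring

lemma exists_abs_rpow_neg_mul_sum_sub_le {α : ℝ} (hα : 0 < α) :
    ∃ C : ℝ, 0 < C ∧ ∀ p : ℕ, p.Prime →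
      |(p : ℝ) ^ (-α) * ∑ q ∈ (range p).filter Nat.Prime, (q : ℝ) ^ α -
        (powLog 1 1 p / (α + 1) + powLog 1 2 p / (α + 1) ^ 2)| ≤ C * powLog 1 3 p := by
  obtain ⟨C, hC, h⟩ := exists_abs_sum_powLog_primes_sub_le hα 0
  obtain ⟨D, hD, h1⟩ := exists_one_le_powLog (by norm_num : (1 / 2 : ℝ) ≤ 1) 3
  refine ⟨C + D, by positivity, fun p hp ↦ ?_⟩
  have hp2 : (2:ℝ) ≤ p := by exact_mod_cast hp.two_le
  have hp1 : (1:ℝ) < p := by linarith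
  have hs : ∑ q ∈ (Icc 2 ⌊(p:ℝ)⌋₊).filter Nat.Prime, powLog α 0 q =
      ∑ q ∈ (range p).filter Nat.Prime, (q : ℝ) ^ α + (p : ℝ) ^ α := by
    have : (Icc 2 ⌊(p:ℝ)⌋₊).filter Nat.Prime = insert p ((range p).filter Nat.Prime) := by
      ext q
      simp only [Nat.floor_natCast, mem_filter, mem_Icc, mem_insert, mem_range]
      constructor
      · rintro ⟨⟨_, h⟩, hq⟩
        rcases h.eq_or_lt with h | h
        · exact Or.inl h
        · exact Or.inr ⟨h, hq⟩
      · rintro (rfl | ⟨h, hq⟩)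
        · exact ⟨⟨hp.two_le, le_rfl⟩, hp⟩
        · exact ⟨⟨hq.two_le, h.le⟩, hq⟩
    rw [this, sum_insert (by simp), add_comm]
    simp [powLog]
  have hpow : ∀ j, (p : ℝ) ^ (-α) * powLog (α + 1) j p = powLog 1 j p := fun j ↦ by
    rw [rpow_mul_powLog _ _ _ hp1, neg_add_cancel_left]
  have hone : (p : ℝ) ^ (-α) * (p : ℝ) ^ α = 1 := by
    rw [← Real.rpow_add (by linarith), neg_add_cancel, Real.rpow_zero]
  have h2 := mul_le_mul_of_nonneg_left (h p hp2) (by positivity : 0 ≤ (p : ℝ) ^ (-α))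
  rw [hs, ← abs_of_nonneg (by positivity : 0 ≤ (p : ℝ) ^ (-α)), ← abs_mul,
    abs_of_nonneg (by positivity : 0 ≤ (p : ℝ) ^ (-α)), mul_left_comm, hpow (0 + 3)] at h2
  have e : (p : ℝ) ^ (-α) * (∑ q ∈ (range p).filter Nat.Prime, (q : ℝ) ^ α + (p : ℝ) ^ α -
      (powLog (α + 1) (0 + 1) p / (α + 1) +
        ((0 : ℕ) + 1) * powLog (α + 1) (0 + 2) p / (α + 1) ^ 2)) =
      (p : ℝ) ^ (-α) * ∑ q ∈ (range p).filter Nat.Prime, (q : ℝ) ^ α -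
        (powLog 1 1 p / (α + 1) + powLog 1 2 p / (α + 1) ^ 2) + 1 := by
    rw [← hpow 1, ← hpow 2]
    simp only [zero_add, Nat.cast_zero]
    linear_combination hone
  rw [e] at h2
  have h3 := h1 p hp2
  rw [abs_le] at h2 ⊢
  constructor <;> linarith [powLog_pos 1 3 hp1]

lemma exists_abs_double_sum_sub_le {α : ℝ} (hα : 0 < α) :
    ∃ C : ℝ, 0 < C ∧ ∀ y : ℝ, 2 ≤ y →
      |∑ p ∈ (Icc 2 ⌊y⌋₊).filter Nat.Prime,
          (p : ℝ) ^ (-α) * ∑ q ∈ (range p).filter Nat.Prime, (q : ℝ) ^ α -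
        (1 / (2 * (α + 1)) * powLog 2 2 y +
          (α + 2) / (2 * (α + 1) ^ 2) * powLog 2 3 y)| ≤ C * powLog 2 4 y := by
  obtain ⟨A, hA, hA'⟩ := exists_abs_rpow_neg_mul_sum_sub_le hα
  obtain ⟨B₁, hB₁, h₁⟩ := exists_abs_sum_powLog_primes_sub_le one_pos 1
  obtain ⟨B₂, hB₂, h₂⟩ := exists_abs_sum_powLog_primes_sub_le one_pos 2
  obtain ⟨B₃, hB₃, h₃⟩ := exists_abs_sum_powLog_primes_le one_pos 3
  refine ⟨A * B₃ + B₁ / (α + 1) + (2 * B₂ + 3 / 4) / (α + 1) ^ 2, by positivity, fun y hy ↦ ?_⟩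
  have g₁ := h₁ y hy
  have g₂ := h₂ y hy
  have g₃ := h₃ y hy
  norm_num at g₁ g₂ g₃
  set F := (Icc 2 ⌊y⌋₊).filter Nat.Prime
  set S₁ := ∑ p ∈ F, powLog 1 1 p
  set S₂ := ∑ p ∈ F, powLog 1 2 p
  have p4 := powLog_pos 2 4 (by linarith : 1 < y)
  have g₂' : |S₂ - powLog 2 3 y / 2| ≤ (2 * B₂ + 3 / 4) * powLog 2 4 y := by
    have h5 := mul_le_mul_of_nonneg_left (powLog_succ_le 2 4 hy) hB₂.le
    rw [abs_le] at g₂ ⊢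
    norm_num at h5
    constructor <;> linarith
  have hsum : |∑ p ∈ F, (p : ℝ) ^ (-α) * ∑ q ∈ (range p).filter Nat.Prime, (q : ℝ) ^ α -
      (S₁ / (α + 1) + S₂ / (α + 1) ^ 2)| ≤ A * (B₃ * powLog 2 4 y) := by
    rw [sum_div, sum_div, ← sum_add_distrib, ← sum_sub_distrib]
    refine (abs_sum_le_sum_abs _ _).trans ?_
    refine (sum_le_sum fun p hp ↦ hA' p (mem_filter.mp hp).2).trans ?_
    rw [← mul_sum]
    gcongr
  have hα1 : 0 < α + 1 := by linarith
  have k₁ : |(S₁ - (powLog 2 2 y / 2 + 2 * powLog 2 3 y / 4)) / (α + 1)| ≤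
      B₁ / (α + 1) * powLog 2 4 y := by
    rw [abs_div, abs_of_pos hα1, div_mul_eq_mul_div]
    gcongr
  have k₂ : |(S₂ - powLog 2 3 y / 2) / (α + 1) ^ 2| ≤
      (2 * B₂ + 3 / 4) / (α + 1) ^ 2 * powLog 2 4 y := by
    rw [abs_div, abs_of_pos (pow_pos hα1 2), div_mul_eq_mul_div]
    gcongr
  have e : ∀ T : ℝ, T - (1 / (2 * (α + 1)) * powLog 2 2 y +
      (α + 2) / (2 * (α + 1) ^ 2) * powLog 2 3 y) = (T - (S₁ / (α + 1) + S₂ / (α + 1) ^ 2)) +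
      (S₁ - (powLog 2 2 y / 2 + 2 * powLog 2 3 y / 4)) / (α + 1) +
      (S₂ - powLog 2 3 y / 2) / (α + 1) ^ 2 := fun T ↦ by
    field_simp
    ring
  rw [e]
  refine (abs_add_three _ _ _).trans ?_
  linarith

lemma powLog_two_sqrt (j : ℕ) {x : ℝ} (hx : 0 ≤ x) :
    powLog 2 j √x = 2 ^ j * (x / Real.log x ^ j) := by
  rw [powLog, Real.rpow_two, Real.sq_sqrt hx, Real.log_sqrt hx, div_pow]
  simp [div_eq_mul_inv]
  ring

end PrimeSums

/-- For `α > 0`,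
`Σ_{p ≤ √x} p^{-α} Σ_{q < p} q^α
  = (2/(α+1))·x/log²x + ((4α+8)/(α+1)²)·x/log³x + O(x/log⁴x)`,
the sums ranging over primes. -/
theorem I1_asymptotic (α : ℝ) (hα : 0 < α) :
    (fun x : ℝ =>
        (∑ p ∈ (Finset.Icc 2 ⌊Real.sqrt x⌋₊).filter Nat.Prime,
            (p : ℝ) ^ (-α) * ∑ q ∈ (Finset.range p).filter Nat.Prime, (q : ℝ) ^ α)
        - ((2 / (α + 1)) * (x / Real.log x ^ 2)
          + ((4 * α + 8) / (α + 1) ^ 2) * (x / Real.log x ^ 3)))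
      =O[atTop] (fun x : ℝ => x / Real.log x ^ 4) := by
  obtain ⟨C, hC, h⟩ := PrimeSums.exists_abs_double_sum_sub_le hα
  refine Asymptotics.IsBigO.of_bound (C * 2 ^ 4) ?_
  filter_upwards [eventually_ge_atTop 4] with x hx
  have hx0 : 0 ≤ x := by linarith
  have h2 : 2 ≤ √x := Real.le_sqrt_of_sq_le (by linarith)
  have h3 := h (√x) h2
  rw [PrimeSums.powLog_two_sqrt 2 hx0, PrimeSums.powLog_two_sqrt 3 hx0,
    PrimeSums.powLog_two_sqrt 4 hx0] at h3
  have hl := Real.log_pos (by linarith : 1 < x)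
  rw [Real.norm_eq_abs, Real.norm_of_nonneg (by positivity), mul_assoc]
  convert h3 using 3
  field_simp
  ring
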